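/- arXiv:2002.11266 — 9 statements merged into one kernel-verified Lean document; each statement's English description precedes it below -/
import Mathlib

section
/- Let n be an even integer with n ≥ 8, let q ≥ 2, and let C be an (n,m,q) wide-sense 2-frameproof code. Then m ≤ (n choose n/2 − 1) − n/2 + 1. -/
/-- The wide-sense descendant set of a set `X` of words: all words agreeing with the
words of `X` on every position undetectable for `X` (i.e. where all words of `X` agree). -/
def wdesc {n : ℕ} {Q : Type*} (X : Finset (Fin n → Q)) : Set (Fin n → Q) :=
  {y | ∀ i : Fin n, (∀ x ∈ X, ∀ x' ∈ X, x i = x' i) → ∀ x ∈ X, y i = x i}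

/-- A code `C` is wide-sense 2-frameproof if `wdesc X ∩ C = X` for every nonempty
subset `X ⊆ C` with `|X| ≤ 2`. -/
def IsWFP2 {n : ℕ} {Q : Type*} (C : Finset (Fin n → Q)) : Prop :=
  ∀ X : Finset (Fin n → Q), X ⊆ C → X.Nonempty → X.card ≤ 2 →
    wdesc X ∩ (C : Set (Fin n → Q)) = (X : Set (Fin n → Q))

open Finset in
/-- Colexicographic initial segments exist in every possible cardinality. -/
theorem exists_isInitSeg_card_eq {n r : ℕ} (a : ℕ) (ha : a ≤ n.choose r) :
    ∃ 𝒞 : Finset (Finset (Fin n)), Colex.IsInitSeg 𝒞 r ∧ #𝒞 = a := by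
  induction a with
  | zero => exact ⟨∅, by simp, rfl⟩
  | succ a ih =>
    obtain ⟨𝒞, h𝒞, hcard⟩ := ih (by omega)
    have hne : (powersetCard r (univ : Finset (Fin n)) \ 𝒞).Nonempty := by
      rw [← card_pos]
      have := le_card_sdiff 𝒞 (powersetCard r (univ : Finset (Fin n)))
      rw [card_powersetCard, card_univ, Fintype.card_fin] at this
      omega
    obtain ⟨s, hs, hmin⟩ := exists_min_image _ (fun s : Finset (Fin n) => toColex s) hne
    simp only [mem_sdiff, mem_powersetCard, subset_univ, true_and] at hs hmin
    refine ⟨insert s 𝒞, ⟨?_, ?_⟩, by rw [card_insert_of_notMem hs.2, hcard]⟩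
    · intro t ht
      rcases mem_insert.1 (mem_coe.1 ht) with rfl | ht
      · exact hs.1
      · exact h𝒞.1 ht
    · rintro t u ht ⟨hlt, hu⟩
      rcases mem_insert.1 ht with rfl | ht
      · by_contra hcon
        exact (hmin u ⟨hu, fun h => hcon (mem_insert_of_mem h)⟩).not_gt hlt
      · exact mem_insert_of_mem (h𝒞.2 ht ⟨hlt, hu⟩)

open Finset in
/-- The sets avoiding the largest point form a colexicographic initial segment. -/
theorem isInitSeg_powersetCard_erase_last {n r : ℕ} :
    Colex.IsInitSeg (powersetCard r (univ.erase (Fin.last n))) r := by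
  refine ⟨fun s hs => (mem_powersetCard.1 hs).2, ?_⟩
  rintro s t hs ⟨hlt, ht⟩
  refine mem_powersetCard.2 ⟨fun i hi => mem_erase.2 ⟨?_, mem_univ _⟩, ht⟩
  rintro rfl
  have hlast : Fin.last n ∉ s := fun h => by simpa using (mem_powersetCard.1 hs).1 h
  obtain ⟨w, hw, hmax⟩ := Colex.toColex_lt_toColex_iff_exists_forall_lt.1 hlt
  exact (hmax.2 _ hi hlast).not_ge (Fin.le_last w)

open Finset FinsetFamily in
/-- A uniform family no larger than the family of all `r`-sets avoiding a point satisfies the local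
LYM inequality of a ground set with one point fewer. -/
theorem card_mul_le_card_shadow_mul_of_card_le {n r : ℕ} {𝒜 : Finset (Finset (Fin n))}
    (h𝒜 : (𝒜 : Set (Finset (Fin n))).Sized r) (hr : 0 < r) (hrn : r < n)
    (hcard : #𝒜 ≤ (n - 1).choose r) : #𝒜 * r ≤ #(∂ 𝒜) * (n - r) := by
  obtain ⟨n, rfl⟩ : ∃ N, n = N + 1 := ⟨n - 1, by omega⟩
  rw [Nat.add_sub_cancel] at hcard
  obtain ⟨𝒞, h𝒞, h𝒞card⟩ := exists_isInitSeg_card_eq (n := n + 1) (r := r) #𝒜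
    (hcard.trans (Nat.choose_le_choose r n.le_succ))
  have hsub : 𝒞 ⊆ powersetCard r (univ.erase (Fin.last n)) := by
    rcases h𝒞.total isInitSeg_powersetCard_erase_last with h | h
    · exact h
    · refine (eq_of_subset_of_card_le h ?_).ge
      simpa [h𝒞card] using hcard
  refine le_trans ?_ (Nat.mul_le_mul_right _ (kruskal_katona h𝒜 h𝒞card.le h𝒞))
  rw [← h𝒞card]
  let i : DecidableRel ((· ⊆ ·) : Finset (Fin (n + 1)) → Finset (Fin (n + 1)) → Prop) :=
    fun _ _ => Classical.dec _
  refine card_mul_le_card_mul' (· ⊆ ·) (fun s hs => ?_) (fun t ht => ?_)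
  · rw [← h𝒞.1 hs, ← card_image_of_injOn s.erase_injOn]
    refine card_le_card ?_
    simp_rw [image_subset_iff, mem_bipartiteBelow]
    exact fun a ha => ⟨erase_mem_shadow hs ha, erase_subset _ _⟩
  · have htcard : #t = r - 1 := h𝒞.1.shadow ht
    have htsub : t ⊆ univ.erase (Fin.last n) := by
      obtain ⟨s, hs, hts⟩ := exists_subset_of_mem_shadow ht
      exact hts.trans (mem_powersetCard.1 (hsub hs)).1
    have hcompl : #((univ.erase (Fin.last n)) \ t) = n + 1 - r := by
      rw [card_sdiff_of_subset htsub, card_erase_of_mem (mem_univ _), card_univ,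
        Fintype.card_fin, htcard]
      omega
    rw [← hcompl]
    refine le_trans (card_le_card (t := ((univ.erase (Fin.last n)) \ t).image
      (fun a => insert a t)) fun s hs => ?_) card_image_le
    rw [mem_bipartiteAbove] at hs
    obtain ⟨a, ha, rfl⟩ := exists_eq_insert_iff.2 ⟨hs.2, by rw [h𝒞.1 hs.1, htcard]; omega⟩
    refine mem_image.2 ⟨a, mem_sdiff.2 ⟨?_, ha⟩, rfl⟩
    exact (mem_powersetCard.1 (hsub hs.1)).1 (mem_insert_self a t)

open Finset FinsetFamily in
/-- If a nonempty family of large sets satisfies a local LYM inequality with ratio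
`(k + 1) / (k - 1)`, its shadow exceeds it by at least `k`. -/
theorem card_add_le_card_shadow {n k r : ℕ} {𝒜 : Finset (Finset (Fin n))}
    (h𝒜 : (𝒜 : Set (Finset (Fin n))).Sized r) (hne : 𝒜.Nonempty) (hkr : k + 1 ≤ r)
    (hrn : r < n) (hk : 1 < k) (hratio : #𝒜 * (k + 1) ≤ #(∂ 𝒜) * (k - 1)) :
    #𝒜 + k ≤ #(∂ 𝒜) := by
  obtain ⟨A, hA⟩ := hne
  have herase : ∀ B ∈ 𝒜, B.image B.erase ⊆ ∂ 𝒜 := fun B hB =>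
    image_subset_iff.2 fun a ha => erase_mem_shadow hB ha
  have hcardim : ∀ B ∈ 𝒜, #(B.image B.erase) = r := fun B hB => by
    rw [card_image_of_injOn B.erase_injOn, h𝒜 hB]
  rcases Nat.lt_or_ge r #𝒜 with hlarge | hsmall
  · have hlovasz := kruskal_katona_lovasz_form (i := 1) (k := r + 1) (by omega) r.le_succ hrn h𝒜
      (by simpa using hlarge)
    rw [Function.iterate_one] at hlovasz
    have hchoose : (r + 1).choose (r - 1) * 2 = (r + 1) * r := by
      rw [show r - 1 = r + 1 - 2 by omega, Nat.choose_symm (by omega), Nat.choose_two_right,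
        Nat.div_mul_cancel (Nat.even_mul_pred_self _).two_dvd]
      simp
    have hsq : (k + 2) * (k + 1) ≤ (r + 1) * r :=
      Nat.mul_le_mul (by omega) hkr
    obtain ⟨k, rfl⟩ : ∃ j, k = j + 1 := ⟨k - 1, by omega⟩
    rw [Nat.add_sub_cancel] at hratio
    by_contra! hcon
    nlinarith
  · rcases Nat.lt_or_ge 1 #𝒜 with htwo | hone
    · obtain ⟨A, hA, B, hB, hAB⟩ := one_lt_card.1 htwo
      have hinter : A.image A.erase ∩ B.image B.erase ⊆ {A ∩ B} := by
        intro T hT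
        obtain ⟨hTA, hTB⟩ := mem_inter.1 hT
        obtain ⟨a, ha, rfl⟩ := mem_image.1 hTA
        obtain ⟨b, hb, hab⟩ := mem_image.1 hTB
        have hsub : A.erase a ⊆ A ∩ B :=
          subset_inter (erase_subset _ _) (hab ▸ erase_subset _ _)
        refine mem_singleton.2 (eq_of_subset_of_card_le hsub ?_)
        have hlt : #(A ∩ B) < #A := card_lt_card (inter_subset_left.ssubset_of_ne fun h =>
          hAB (eq_of_subset_of_card_le (inter_eq_left.1 h) (by rw [h𝒜 hA, h𝒜 hB])))
        rw [card_erase_of_mem ha]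
        omega
      have h1 := card_le_card hinter
      have h2 := card_le_card (union_subset (herase A hA) (herase B hB))
      have h3 := card_union_add_card_inter (A.image A.erase) (B.image B.erase)
      rw [hcardim A hA, hcardim B hB] at h3
      rw [card_singleton] at h1
      omega
    · have h1 := card_le_card (herase A hA)
      rw [hcardim A hA] at h1
      omega

open Finset FinsetFamily in
/-- In an antichain, the members of size at least `r` are at most as many as the `r`-sets below
them, provided `r` is at least about half the size of the ground set. -/
theorem IsAntichain.card_filter_le_card_falling {n : ℕ} {𝒜 : Finset (Finset (Fin n))}
    (h𝒜 : IsAntichain (· ⊆ ·) (𝒜 : Set (Finset (Fin n)))) {r : ℕ} (hr : n ≤ 2 * r + 1) :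
    #{A ∈ 𝒜 | r ≤ #A} ≤ #(falling r 𝒜) := by
  induction hd : n + 1 - r generalizing r with
  | zero =>
    rw [filter_false_of_mem]
    · simp
    · intro A _ hA
      have := card_le_univ A
      rw [Fintype.card_fin] at this
      omega
  | succ d ih =>
    have hsplit : #{A ∈ 𝒜 | r ≤ #A} ≤ #(𝒜 # r) + #{A ∈ 𝒜 | r + 1 ≤ #A} := by
      refine (card_le_card fun A hA => ?_).trans (card_union_le _ _)
      grind [mem_slice]
    have hlym := local_lubell_yamamoto_meshalkin_inequality_mul (sized_falling (r + 1) 𝒜)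
    rw [Fintype.card_fin] at hlym
    have hshadow : #(falling (r + 1) 𝒜) ≤ #(∂ (falling (r + 1) 𝒜)) :=
      Nat.le_of_mul_le_mul_right (hlym.trans (Nat.mul_le_mul_left _ (by omega))) r.succ_pos
    have hfall := card_union_of_disjoint (IsAntichain.disjoint_slice_shadow_falling
      (m := r) (n := r + 1) h𝒜)
    rw [slice_union_shadow_falling_succ] at hfall
    have := ih (r := r + 1) (by omega) (by omega)
    omega

open Finset in
/-- The Erdős–Ko–Rado theorem for families no two members of which cover the ground set. -/
theorem card_le_choose_of_union_ne_univ {k r : ℕ} {𝒜 : Finset (Finset (Fin (2 * k)))}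
    (h𝒜 : (𝒜 : Set (Finset (Fin (2 * k)))).Sized r) (hkr : k ≤ r) (hrk : r < 2 * k)
    (hcover : ∀ A ∈ 𝒜, ∀ B ∈ 𝒜, A ∪ B ≠ univ) : #𝒜 ≤ (2 * k - 1).choose r := by
  have hekr := erdos_ko_rado (𝒜 := 𝒜.compls) (r := 2 * k - r) (fun A hA B hB hAB => ?_)
    (fun A hA => ?_) (by omega)
  · rw [card_compls] at hekr
    rwa [show 2 * k - r - 1 = 2 * k - 1 - r by omega, Nat.choose_symm (by omega)] at hekr
  · rw [mem_coe, mem_compls] at hA hB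
    refine hcover _ hA _ hB ?_
    rw [← compl_inter, disjoint_iff_inter_eq_empty.1 hAB, compl_empty]
  · rw [mem_coe, mem_compls] at hA
    have := h𝒜 hA
    rw [card_compl, Fintype.card_fin] at this
    have := card_le_univ A
    rw [Fintype.card_fin] at this
    omega

open Finset FinsetFamily in
/-- An antichain on `2 * k` points, no two members of which cover, loses at least `k` from the
extremal size when it has a member of size outside `{k - 1, k}`. -/
theorem card_add_le_choose_of_card_ne {k : ℕ} (hk : 4 ≤ k) {𝒜 : Finset (Finset (Fin (2 * k)))}
    (h𝒜 : IsAntichain (· ⊆ ·) (𝒜 : Set (Finset (Fin (2 * k)))))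
    (hcover : ∀ A ∈ 𝒜, ∀ B ∈ 𝒜, A ∪ B ≠ univ) {A : Finset (Fin (2 * k))} (hA : A ∈ 𝒜)
    (hA1 : #A ≠ k - 1) (hA2 : #A ≠ k) : #𝒜 + k ≤ (2 * k).choose (k - 1) := by
  have hfallcover : ∀ r, ∀ S ∈ falling r 𝒜, ∀ T ∈ falling r 𝒜, S ∪ T ≠ univ := by
    intro r S hS T hT h
    obtain ⟨⟨B, hB, hSB⟩, -⟩ := mem_falling.1 hS
    obtain ⟨⟨D, hD, hTD⟩, -⟩ := mem_falling.1 hT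
    exact hcover B hB D hD (univ_subset_iff.1 (h ▸ union_subset_union hSB hTD))
  have hcompl : IsAntichain (· ⊆ ·) (𝒜.compls : Set (Finset (Fin (2 * k)))) := by
    intro S hS T hT hST hsub
    rw [mem_coe, mem_compls] at hS hT
    exact h𝒜 hT hS (fun h => hST (compl_injective h.symm)) (compl_subset_compl.2 hsub)
  -- the members larger than `k`
  have hhigh := h𝒜.card_filter_le_card_falling (r := k + 1) (by omega)
  have hhighratio := card_mul_le_card_shadow_mul_of_card_le (sized_falling (k + 1) 𝒜) (by omega)
    (by omega) (card_le_choose_of_union_ne_univ (sized_falling (k + 1) 𝒜) (by omega) (by omega)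
      (hfallcover _))
  rw [show 2 * k - (k + 1) = k - 1 by omega] at hhighratio
  have hhighle : #(falling (k + 1) 𝒜) ≤ #(∂ (falling (k + 1) 𝒜)) :=
    Nat.le_of_mul_le_mul_right (hhighratio.trans (Nat.mul_le_mul_left _ (by omega))) k.succ_pos
  have hhighgain : k + 1 ≤ #A → #(falling (k + 1) 𝒜) + k ≤ #(∂ (falling (k + 1) 𝒜)) := by
    intro hAk
    obtain ⟨S, hSA, hS⟩ := exists_subset_card_eq hAk
    exact card_add_le_card_shadow (sized_falling _ _) ⟨S, mem_falling.2 ⟨⟨A, hA, hSA⟩, hS⟩⟩ le_rfl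
      (by omega) (by omega) hhighratio
  -- the middle layers
  have hmidratio := card_mul_le_card_shadow_mul_of_card_le (sized_falling k 𝒜) (by omega)
    (by omega) (card_le_choose_of_union_ne_univ (sized_falling k 𝒜) le_rfl (by omega)
      (hfallcover _))
  have hmidle : #(falling k 𝒜) ≤ #(∂ (falling k 𝒜)) :=
    Nat.le_of_mul_le_mul_right (hmidratio.trans (Nat.mul_le_mul_left _ (by omega)))
      (by omega : 0 < k)
  have hmid := card_union_of_disjoint (IsAntichain.disjoint_slice_shadow_falling
    (m := k) (n := k + 1) h𝒜)
  rw [slice_union_shadow_falling_succ] at hmid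
  have hlow := card_union_of_disjoint (IsAntichain.disjoint_slice_shadow_falling
    (m := k - 1) (n := k) h𝒜)
  have hunion := slice_union_shadow_falling_succ (k - 1) 𝒜
  rw [show k - 1 + 1 = k by omega] at hunion
  rw [hunion] at hlow
  -- the members smaller than `k - 1`
  have hsmall := hcompl.card_filter_le_card_falling (r := k + 2) (by omega)
  have hsmallratio := local_lubell_yamamoto_meshalkin_inequality_mul
    (sized_falling (k + 2) 𝒜.compls)
  rw [Fintype.card_fin, show 2 * k - (k + 2) + 1 = k - 1 by omega] at hsmallratio
  have hsmallle : #(falling (k + 2) 𝒜.compls) ≤ #(∂ (falling (k + 2) 𝒜.compls)) :=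
    Nat.le_of_mul_le_mul_right (hsmallratio.trans (Nat.mul_le_mul_left _ (by omega)))
      (by omega : 0 < k + 2)
  have hsmallgain : #A + 1 < k →
      #(falling (k + 2) 𝒜.compls) + k ≤ #(∂ (falling (k + 2) 𝒜.compls)) := by
    intro hAk
    obtain ⟨S, hSA, hS⟩ := exists_subset_card_eq (s := Aᶜ) (n := k + 2) (by
      rw [card_compl, Fintype.card_fin]; omega)
    exact card_add_le_card_shadow (sized_falling _ _)
      ⟨S, mem_falling.2 ⟨⟨Aᶜ, by simpa using hA, hSA⟩, hS⟩⟩ (by omega) (by omega) (by omega)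
      ((Nat.mul_le_mul_left _ (by omega)).trans hsmallratio)
  have hcard : #𝒜 ≤ #{B ∈ 𝒜 | k + 1 ≤ #B} + #(𝒜 # k) + #(𝒜 # (k - 1)) +
      #{B ∈ 𝒜.compls | k + 2 ≤ #B} := by
    rw [← card_compls {B ∈ 𝒜.compls | k + 2 ≤ #B}]
    refine (card_le_card fun B hB => ?_).trans ((card_union_le _ _).trans
      (Nat.add_le_add_right ((card_union_le _ _).trans
        (Nat.add_le_add_right (card_union_le _ _) _)) _))
    simp only [mem_union, mem_filter, mem_slice, mem_compls, compl_compl, card_compl,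
      Fintype.card_fin, hB, true_and]
    omega
  have hdisj : Disjoint (falling (k - 1) 𝒜) (∂ (falling (k + 2) 𝒜.compls)).compls := by
    rw [disjoint_left]
    intro T hT hT'
    obtain ⟨⟨B, hB, hTB⟩, -⟩ := mem_falling.1 hT
    obtain ⟨S, hS, hTS⟩ := exists_subset_of_mem_shadow (mem_compls.1 hT')
    have hne : Tᶜ ≠ S := by
      rintro rfl
      have h1 := sized_falling (k + 2) 𝒜.compls hS
      have h2 := (sized_falling (k + 2) 𝒜.compls).shadow (mem_compls.1 hT')
      omega
    obtain ⟨⟨D, hD, hSD⟩, -⟩ := mem_falling.1 hS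
    have hss : Tᶜ ⊂ D := (hTS.ssubset_of_ne hne).trans_subset hSD
    have hDT : Dᶜ ⊂ T := by simpa using compl_ssubset_compl.2 hss
    have hDB : Dᶜ ⊂ B := hDT.trans_subset hTB
    exact h𝒜 (mem_compls.1 hD) hB hDB.ne hDB.subset
  have htotal := Set.Sized.card_le (r := k - 1)
    (𝒜 := falling (k - 1) 𝒜 ∪ (∂ (falling (k + 2) 𝒜.compls)).compls) (by
      intro T hT
      rcases mem_union.1 (mem_coe.1 hT) with hT | hT
      · exact sized_falling _ _ hT
      · have := (sized_falling (k + 2) 𝒜.compls).shadow (mem_compls.1 hT)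
        rw [card_compl, Fintype.card_fin] at this
        omega)
  rw [card_union_of_disjoint hdisj, card_compls, Fintype.card_fin] at htotal
  rcases Nat.lt_or_ge k #A with h | h
  · have := hhighgain h
    omega
  · have := hsmallgain (by omega)
    omega

theorem two_mul_sq_le_choose {k : ℕ} (hk : 4 ≤ k) :
    2 * k ^ 2 ≤ (2 * k).choose (k - 1) := by
  induction k, hk using Nat.le_induction with
  | base => decide
  | succ k hk ih =>
    obtain ⟨j, rfl⟩ : ∃ j, k = j + 2 := ⟨k - 2, by omega⟩
    have hmid : (2 * (j + 2)).choose (j + 1) ≤ (2 * (j + 2)).choose (j + 2) := by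
      simpa using Nat.choose_le_middle (j + 1) (2 * (j + 2))
    have hrec : (2 * (j + 2 + 1)).choose (j + 2) = (2 * (j + 2)).choose j +
        2 * (2 * (j + 2)).choose (j + 1) + (2 * (j + 2)).choose (j + 2) := by
      rw [show 2 * (j + 2 + 1) = 2 * (j + 2) + 1 + 1 by ring, Nat.choose_succ_succ,
        Nat.choose_succ_succ (2 * (j + 2)) j, Nat.choose_succ_succ (2 * (j + 2)) (j + 1)]
      ring
    rw [show j + 2 + 1 - 1 = j + 2 by omega, hrec]
    rw [show j + 2 - 1 = j + 1 by omega] at ih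
    nlinarith

open Finset FinsetFamily in
/-- A family of `(k - 1)`- and `k`-subsets of `2 * k` points, no two members of which cover and
whose pairwise symmetric differences have size at most `k + 1`, is at least `k` below the
extremal size. -/
theorem card_add_le_choose_of_card_symmDiff_le {k : ℕ} (hk : 4 ≤ k)
    {𝒜 : Finset (Finset (Fin (2 * k)))} (hsize : ∀ A ∈ 𝒜, #A = k - 1 ∨ #A = k)
    (hdiff : ∀ A ∈ 𝒜, ∀ B ∈ 𝒜, #(symmDiff A B) ≤ k + 1) :
    #𝒜 + k ≤ (2 * k).choose (k - 1) := by
  have hsymm : ∀ A B : Finset (Fin (2 * k)), #(symmDiff A B) + 2 * #(A ∩ B) = #A + #B := by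
    intro A B
    rw [symmDiff_def, sup_eq_union, card_union_of_disjoint disjoint_sdiff_sdiff]
    have h1 := card_sdiff_add_card_inter A B
    have h2 := card_sdiff_add_card_inter B A
    rw [inter_comm B A] at h2
    omega
  have hsized : ∀ r, (𝒜 # r : Set (Finset (Fin (2 * k)))).Sized r := fun r => sized_slice
  have hM : #(𝒜 # (k - 1)) ≤ (2 * k - 1).choose (k - 1 - 1) := by
    refine erdos_ko_rado (fun A hA B hB hAB => ?_) (hsized _) (by omega)
    rw [mem_coe, mem_slice] at hA hB
    have h1 := hsymm A B
    have h2 := hdiff A hA.1 B hB.1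
    rw [disjoint_iff_inter_eq_empty.1 hAB, card_empty] at h1
    omega
  have hK2 : ∀ A ∈ 𝒜 # k, ∀ B ∈ 𝒜 # k, 2 ≤ #(A ∩ B) := by
    intro A hA B hB
    rw [mem_slice] at hA hB
    have h1 := hsymm A B
    have h2 := hdiff A hA.1 B hB.1
    omega
  have hK : #(𝒜 # k) ≤ (2 * k - 1).choose k := by
    have := erdos_ko_rado (fun A hA B hB hAB => ?_) (hsized k) (by omega)
    · rwa [← Nat.choose_symm (by omega), show 2 * k - 1 - (k - 1) = k by omega] at this
    · have := hK2 A hA B hB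
      rw [disjoint_iff_inter_eq_empty.1 hAB, card_empty] at this
      omega
  have hcsized : ((𝒜 # k).compls : Set (Finset (Fin (2 * k)))).Sized k := by
    intro A hA
    have := hsized k (mem_compls.1 hA)
    rw [card_compl, Fintype.card_fin] at this
    omega
  have hshadow : ∀ ℬ : Finset (Finset (Fin (2 * k))), (ℬ : Set (Finset (Fin (2 * k)))).Sized k →
      #ℬ ≤ (2 * k - 1).choose k → #ℬ ≤ #(∂ ℬ) := by
    intro ℬ hℬ hcard
    have := card_mul_le_card_shadow_mul_of_card_le hℬ (by omega) (by omega) hcard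
    exact Nat.le_of_mul_le_mul_right (this.trans (Nat.mul_le_mul_left _ (by omega)))
      (by omega : 0 < k)
  have h1 := hshadow _ (hsized k) hK
  have h2 := hshadow _ hcsized (by rwa [card_compls])
  rw [card_compls] at h2
  have hdisj : Disjoint (∂ (𝒜 # k)) (∂ (𝒜 # k).compls) := by
    rw [disjoint_left]
    intro T hT hT'
    obtain ⟨A, hA, hTA⟩ := exists_subset_of_mem_shadow hT
    obtain ⟨B, hB, hTB⟩ := exists_subset_of_mem_shadow hT'
    rw [mem_compls] at hB
    have hTcard := (hsized k).shadow hT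
    have hi := hK2 A hA _ hB
    have hd := card_le_card (subset_inter hTA hTB)
    have hs := card_sdiff_add_card_inter A Bᶜ
    rw [sdiff_compl, inf_eq_inter] at hs
    have hsplit := card_sdiff_add_card_inter A B
    rw [sdiff_eq_inter_compl] at hsplit
    have := hsized k hA
    omega
  have htotal := Set.Sized.card_le (r := k - 1) (𝒜 := ∂ (𝒜 # k) ∪ ∂ (𝒜 # k).compls) (by
    intro T hT
    rcases mem_union.1 (mem_coe.1 hT) with hT | hT
    · exact (hsized k).shadow hT
    · exact hcsized.shadow hT)
  rw [card_union_of_disjoint hdisj, Fintype.card_fin] at htotal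
  have hcard : #𝒜 ≤ #(𝒜 # k) + #(𝒜 # (k - 1)) := by
    refine (card_le_card fun A hA => ?_).trans (card_union_le _ _)
    have := hsize A hA
    simp only [mem_union, mem_slice, hA, true_and]
    tauto
  have hbig := two_mul_sq_le_choose hk
  obtain ⟨j, rfl⟩ : ∃ j, k = j + 2 := ⟨k - 2, by omega⟩
  have habs := Nat.add_one_mul_choose_eq (2 * (j + 2) - 1) j
  rw [show 2 * (j + 2) - 1 + 1 = 2 * (j + 2) by omega] at habs
  rw [show j + 2 - 1 - 1 = j by omega] at hM
  rw [show j + 2 - 1 = j + 1 by omega] at *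
  nlinarith

/-- For even `n ≥ 8`, an `(n,m,q)` wide-sense 2-frameproof code satisfies
`m ≤ C(n, n/2 - 1) - n/2 + 1`. -/
theorem wfp2_upper_bound_even {n m q : ℕ} {Q : Type*} [Fintype Q]
    (hq : Fintype.card Q = q) (hq2 : 2 ≤ q)
    (hn : Even n) (hn8 : 8 ≤ n)
    (C : Finset (Fin n → Q)) (hC : C.card = m) (hwfp : IsWFP2 C) :
    m + n / 2 ≤ n.choose (n / 2 - 1) + 1 := by
  classical
  obtain ⟨k, rfl⟩ : ∃ k, n = 2 * k := hn.two_dvd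
  have hk : 4 ≤ k := by omega
  rw [Nat.mul_div_cancel_left k two_pos]
  subst hC
  have hsep : ∀ x ∈ C, ∀ y ∈ C, ∀ z ∈ C, z ≠ x → z ≠ y → ∃ i, x i = y i ∧ x i ≠ z i := by
    intro x hx y hy z hz hzx hzy
    by_contra! hcon
    have hmem : z ∈ wdesc {x, y} ∩ (C : Set (Fin (2 * k) → Q)) := by
      refine ⟨fun i hi w hw => ?_, hz⟩
      have hxy := hi x (by simp) y (by simp)
      rw [← hcon i hxy]
      exact hi x (by simp) w hw
    rw [hwfp {x, y} (by simp [Finset.insert_subset_iff, hx, hy]) (by simp) Finset.card_le_two]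
      at hmem
    simp [hzx, hzy] at hmem
  let agree : (Fin (2 * k) → Q) → (Fin (2 * k) → Q) → Finset (Fin (2 * k)) :=
    fun x y => Finset.univ.filter fun i => x i = y i
  have hmem : ∀ x y i, i ∈ agree x y ↔ x i = y i := fun x y i => by simp [agree]
  let G : (Fin (2 * k) → Q) → Finset (Finset (Fin (2 * k))) := fun x => (C.erase x).image (agree x)
  have hG : ∀ x A, A ∈ G x ↔ ∃ y ∈ C, y ≠ x ∧ agree x y = A := fun x A => by
    simp only [G, Finset.mem_image, Finset.mem_erase]
    grind
  have hanti : ∀ x ∈ C, ∀ y ∈ C, ∀ z ∈ C, y ≠ x → z ≠ x → agree x y ⊆ agree x z → y = z := by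
    intro x hx y hy z hz hyx hzx hsub
    by_contra hyz
    obtain ⟨i, hi, hi'⟩ := hsep x hx y hy z hz hzx (Ne.symm hyz)
    exact hi' ((hmem x z i).1 (hsub ((hmem x y i).2 hi)))
  have hGcard : ∀ x ∈ C, (G x).card + 1 = C.card := by
    intro x hx
    rw [Finset.card_image_of_injOn, Finset.card_erase_add_one hx]
    intro y hy z hz hyz
    rw [Finset.mem_coe, Finset.mem_erase] at hy hz
    exact hanti x hx y hy.2 z hz.2 hy.1 hz.1 hyz.subset
  have hGanti : ∀ x ∈ C, IsAntichain (· ⊆ ·) (G x : Set (Finset (Fin (2 * k)))) := by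
    intro x hx A hA B hB hAB hsub
    obtain ⟨y, hy, hyx, rfl⟩ := (hG x A).1 hA
    obtain ⟨z, hz, hzx, rfl⟩ := (hG x B).1 hB
    exact hAB (congrArg (agree x) (hanti x hx y hy z hz hyx hzx hsub))
  have hGcover : ∀ x ∈ C, ∀ A ∈ G x, ∀ B ∈ G x, A ∪ B ≠ Finset.univ := by
    intro x hx A hA B hB huniv
    obtain ⟨y, hy, hyx, rfl⟩ := (hG x A).1 hA
    obtain ⟨z, hz, hzx, rfl⟩ := (hG x B).1 hB
    obtain ⟨i, hi, hi'⟩ := hsep y hy z hz x hx hyx.symm hzx.symm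
    have := huniv ▸ Finset.mem_univ i
    rw [Finset.mem_union, hmem, hmem] at this
    rcases this with h | h
    · exact hi' h.symm
    · exact hi' (hi.trans h.symm)
  by_contra! hcon
  have hsize : ∀ x ∈ C, ∀ A ∈ G x, A.card = k - 1 ∨ A.card = k := by
    intro x hx A hA
    by_contra! hne
    have := card_add_le_choose_of_card_ne hk (hGanti x hx) (hGcover x hx) hA hne.1 hne.2
    have := hGcard x hx
    omega
  obtain ⟨x, hx⟩ : C.Nonempty := by
    rw [← Finset.card_pos]
    by_contra hzero
    have := two_mul_sq_le_choose hk
    nlinarith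
  have := card_add_le_choose_of_card_symmDiff_le hk (hsize x hx) (by
    intro A hA B hB
    obtain ⟨y, hy, hyx, rfl⟩ := (hG x A).1 hA
    obtain ⟨z, hz, hzx, rfl⟩ := (hG x B).1 hB
    by_cases hyz : z = y
    · simp [hyz]
    have hsub : symmDiff (agree x y) (agree x z) ⊆ (agree y z)ᶜ := by
      intro i hi
      rw [Finset.mem_symmDiff, hmem, hmem] at hi
      rw [Finset.mem_compl, hmem]
      grind
    have hcard := Finset.card_le_card hsub
    rw [Finset.card_compl, Fintype.card_fin] at hcard
    have := hsize y hy (agree y z) ((hG y _).2 ⟨z, hz, hyz, rfl⟩)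
    omega)
  have := hGcard x hx
  omega
end

section
/- Let n be an odd integer with n ≥ 7 and n ≡ 1 (mod 4), let q ≥ 2, and let C be an (n,m,q) wide-sense 2-frameproof code. Then m ≤ (n choose (n−1)/2) − (n² − 9)/8 − ⌊(n−5)²/64⌋. -/
open Finset

section Binomial

lemma choose_le_choose_of_half_lt {k a b : ℕ} (ha : k + 1 ≤ a) (hab : a ≤ b) :
    (2 * k + 1).choose b ≤ (2 * k + 1).choose a := by
  induction b, hab using Nat.le_induction with
  | base => rfl
  | succ b hb ih =>
    refine le_trans ?_ ih
    have h := Nat.choose_succ_right_eq (2 * k + 1) b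
    refine Nat.le_of_mul_le_mul_right (c := b + 1) ?_ (by omega)
    rw [h]
    exact Nat.mul_le_mul_left _ (by omega)

lemma choose_mul_le_of_add_two_le {k b : ℕ} (hb : k + 2 ≤ b) :
    (2 * k + 1).choose b * (k + 2) ≤ (2 * k + 1).choose k * k := by
  have h := Nat.choose_succ_right_eq (2 * k + 1) (k + 1)
  rw [Nat.choose_symm_half, show 2 * k + 1 - (k + 1) = k by omega] at h
  rw [← h]
  exact Nat.mul_le_mul_right _ (choose_le_choose_of_half_lt (by omega) hb)

lemma choose_le_choose_half (k b : ℕ) : (2 * k + 1).choose b ≤ (2 * k + 1).choose k := by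
  have h := Nat.choose_le_middle b (2 * k + 1)
  rwa [show (2 * k + 1) / 2 = k by omega] at h

lemma cubic_lt_choose_half {k : ℕ} (hk : 4 ≤ k) :
    (k + 2) * (9 * k ^ 2 + 4 * k) < 8 * (2 * k + 1).choose k + (k + 2) * 12 := by
  induction k, hk using Nat.le_induction with
  | base => decide
  | succ k hk ih =>
    have h : 3 * (2 * k + 1).choose k ≤ (2 * (k + 1) + 1).choose (k + 1) := by
      have h1 := Nat.choose_succ_succ (2 * k + 2) k
      have h2 := Nat.choose_succ_succ (2 * k + 1) k
      have h3 := Nat.choose_symm_half k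
      have h4 := Nat.choose_le_choose k (show 2 * k + 1 ≤ 2 * k + 2 by omega)
      simp only [Nat.succ_eq_add_one] at h1 h2
      rw [show 2 * (k + 1) + 1 = 2 * k + 2 + 1 by ring]
      rw [show 2 * k + 1 + 1 = 2 * k + 2 by ring] at h2
      omega
    nlinarith [mul_le_mul hk hk (by omega) (by omega), mul_le_mul_left hk (k ^ 2)]

end Binomial

section Antichain

variable {α : Type*} [Fintype α]

/-- A weighted form of the Lubell–Yamamoto–Meshalkin inequality. -/
lemma IsAntichain.sum_weight_le {F : Finset (Finset α)}
    (hF : IsAntichain (· ⊆ ·) (F : Set (Finset α))) {M : ℚ} (hM : 0 ≤ M) (c : Finset α → ℚ)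
    (hc : ∀ B ∈ F, c B * (Fintype.card α).choose #B ≤ M) : ∑ B ∈ F, c B ≤ M := by
  calc ∑ B ∈ F, c B ≤ ∑ B ∈ F, M * ((Fintype.card α).choose #B : ℚ)⁻¹ := by
        refine sum_le_sum fun B hB => ?_
        have hpos : (0 : ℚ) < (Fintype.card α).choose #B := by
          exact_mod_cast Nat.choose_pos (card_le_univ B)
        rw [← div_eq_mul_inv, le_div_iff₀ hpos]
        exact hc B hB
    _ = M * ∑ B ∈ F, ((Fintype.card α).choose #B : ℚ)⁻¹ := by rw [mul_sum]
    _ ≤ M * 1 := mul_le_mul_of_nonneg_left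
        (lubell_yamamoto_meshalkin_inequality_sum_inv_choose hF) hM
    _ = M := mul_one M

lemma IsAntichain.card_le_choose_half {k : ℕ} (hα : Fintype.card α = 2 * k + 1)
    {F : Finset (Finset α)} (hF : IsAntichain (· ⊆ ·) (F : Set (Finset α))) :
    #F ≤ (2 * k + 1).choose k := by
  have h := hF.sperner
  rwa [hα, show (2 * k + 1) / 2 = k by omega] at h

lemma IsAntichain.weighted_card_le {k : ℕ} (hk : 0 < k) (hα : Fintype.card α = 2 * k + 1)
    {F : Finset (Finset α)} (hF : IsAntichain (· ⊆ ·) (F : Set (Finset α))) :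
    k * #F + 2 * #{B ∈ F | k + 2 ≤ #B} ≤ k * (2 * k + 1).choose k := by
  have h := hF.sum_weight_le (M := k * (2 * k + 1).choose k) (by positivity)
    (fun B => k + if k + 2 ≤ #B then 2 else 0) (fun B _ => by
      rw [hα]
      split_ifs with hB
      · have := choose_mul_le_of_add_two_le hB
        have : ((2 * k + 1).choose #B * (k + 2) : ℚ) ≤ (2 * k + 1).choose k * k := by
          exact_mod_cast this
        linarith
      · have : ((2 * k + 1).choose #B : ℚ) ≤ (2 * k + 1).choose k := by
          exact_mod_cast choose_le_choose_half k #B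
        rw [add_zero]
        gcongr)
  rw [sum_add_distrib, sum_const, ← sum_filter, sum_const, nsmul_eq_mul, nsmul_eq_mul] at h
  have h' : ((k * #F + 2 * #{B ∈ F | k + 2 ≤ #B} : ℕ) : ℚ) ≤ (k * (2 * k + 1).choose k : ℕ) := by
    push_cast
    linarith
  exact_mod_cast h'

/-- An antichain with a member omitting at most one point is smaller than the middle layer. -/
lemma IsAntichain.mul_card_le_of_two_mul_le {k : ℕ} (hk : 0 < k)
    (hα : Fintype.card α = 2 * k + 1)
    {F : Finset (Finset α)} (hF : IsAntichain (· ⊆ ·) (F : Set (Finset α)))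
    {B : Finset α} (hB : B ∈ F) (hBk : 2 * k ≤ #B) :
    (2 * k + 1) * #F + (2 * k + 1).choose k ≤
      (2 * k + 1) * (2 * k + 1).choose k + (2 * k + 1) := by
  classical
  have h := hF.sum_weight_le (M := (2 * k + 1) * (2 * k + 1).choose k) (by positivity)
    (fun A => if A = B then (2 * k + 1).choose k else 2 * k + 1) (fun A _ => by
      rw [hα]
      split_ifs with hA
      · have h1 : (2 * k + 1).choose #A ≤ 2 * k + 1 := by
          subst hA
          refine (choose_le_choose_of_half_lt (a := 2 * k) (by omega) hBk).trans ?_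
          rw [Nat.choose_succ_self_right]
        have : ((2 * k + 1).choose #A : ℚ) ≤ 2 * k + 1 := by exact_mod_cast h1
        rw [mul_comm]
        gcongr
      · have : ((2 * k + 1).choose #A : ℚ) ≤ (2 * k + 1).choose k := by
          exact_mod_cast choose_le_choose_half k #A
        gcongr)
  rw [← add_sum_erase F _ hB, if_pos rfl,
    sum_congr rfl (fun A hA => if_neg (ne_of_mem_erase hA)), sum_const, nsmul_eq_mul] at h
  have hc := card_erase_add_one hB
  have h' : (((2 * k + 1).choose k + #(F.erase B) * (2 * k + 1) : ℕ) : ℚ) ≤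
      ((2 * k + 1) * (2 * k + 1).choose k : ℕ) := by
    push_cast
    linarith
  have h'' : (2 * k + 1).choose k + #(F.erase B) * (2 * k + 1) ≤
      (2 * k + 1) * (2 * k + 1).choose k := by exact_mod_cast h'
  rw [← hc]
  linarith

variable [DecidableEq α]

lemma card_union_compls_le_choose_half {k : ℕ} (hα : Fintype.card α = 2 * k + 1)
    {G L : Finset (Finset α)} (hLG : L ⊆ G) (hG : IsAntichain (· ⊆ ·) (G : Set (Finset α)))
    (h₁ : ∀ A ∈ L, ∀ B ∈ G, ¬ B ⊆ Aᶜ) (h₂ : ∀ A ∈ L, ∀ B ∈ G, ¬ Aᶜ ⊆ B) :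
    #G + #L ≤ (2 * k + 1).choose k := by
  have hcard : #(L.image compl) = #L := card_image_of_injective _ compl_injective
  have hdisj : Disjoint G (L.image compl) := by
    rw [disjoint_left]
    intro B hB hB'
    obtain ⟨A, hA, rfl⟩ := mem_image.1 hB'
    exact h₁ A hA _ hB subset_rfl
  rw [← hcard, ← card_union_of_disjoint hdisj]
  refine IsAntichain.card_le_choose_half hα ?_
  intro S hS T hT hST hsub
  simp only [coe_union, coe_image, Set.mem_union, Set.mem_image, mem_coe] at hS hT
  rcases hS with hS | ⟨A, hA, rfl⟩ <;> rcases hT with hT | ⟨A', hA', rfl⟩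
  · exact hG hS hT hST hsub
  · exact h₁ A' hA' S hS hsub
  · exact h₂ A hA T hT hsub
  · exact hG (hLG hA') (hLG hA) (fun h => hST (by rw [h])) (compl_subset_compl.1 hsub)

/-- The size bound for an intersecting antichain in which no two members of size `k + 1` cover the
ground set, that is, meet in a single point. -/
lemma card_le_of_intersecting_of_forall_not_compl_subset {k : ℕ} (hk : 0 < k)
    (hα : Fintype.card α = 2 * k + 1) {F : Finset (Finset α)}
    (hF : IsAntichain (· ⊆ ·) (F : Set (Finset α)))
    (hint : ∀ A ∈ F, ∀ B ∈ F, ¬ Disjoint A B)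
    (hG : ∀ A ∈ F, ∀ B ∈ F, #A = k + 1 → #B = k + 1 → ¬ Aᶜ ⊆ B) :
    2 * (k + 2) * #F ≤ (2 * k + 3) * (2 * k + 1).choose k := by
  have hw := hF.weighted_card_le hk hα
  have hnot : ∀ A ∈ F, ∀ B ∈ F, ¬ B ⊆ Aᶜ := fun A hA B hB h =>
    hint A hA B hB (subset_compl_iff_disjoint_left.1 h)
  have hcompl : ∀ A : Finset α, #Aᶜ = 2 * k + 1 - #A := fun A => by rw [card_compl, hα]
  have hmid := card_union_compls_le_choose_half hα (subset_refl {B ∈ F | #B = k + 1})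
    (hF.subset (coe_subset.2 (filter_subset _ _)))
    (fun A hA B hB => hnot A (mem_filter.1 hA).1 B (mem_filter.1 hB).1)
    (fun A hA B hB => hG A (mem_filter.1 hA).1 B (mem_filter.1 hB).1
      (mem_filter.1 hA).2 (mem_filter.1 hB).2)
  have hlow := card_union_compls_le_choose_half hα
    (L := {B ∈ F | #B ≤ k}) (G := {B ∈ F | #B ≤ k + 1})
    (fun B hB => by rw [mem_filter] at hB ⊢; exact ⟨hB.1, by omega⟩)
    (hF.subset (coe_subset.2 (filter_subset _ _)))
    (fun A hA B hB => hnot A (mem_filter.1 hA).1 B (mem_filter.1 hB).1)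
    (fun A hA B hB hsub => by
      rw [mem_filter] at hA hB
      have hle := card_le_card hsub
      rw [hcompl] at hle
      have heq : Aᶜ = B := eq_of_subset_of_card_le hsub (by rw [hcompl]; omega)
      exact hnot A hA.1 B hB.1 heq.ge)
  have hsplit₁ : #{B ∈ F | #B ≤ k + 1} = #{B ∈ F | #B ≤ k} + #{B ∈ F | #B = k + 1} := by
    rw [← card_union_of_disjoint (disjoint_filter.2 fun B _ h => by omega), ← filter_or]
    congr 1
    exact filter_congr fun B _ => by omega
  have hsplit₂ : #F = #{B ∈ F | #B ≤ k + 1} + #{B ∈ F | k + 2 ≤ #B} := by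
    rw [← card_union_of_disjoint (disjoint_filter.2 fun B _ h => by omega), ← filter_or,
      filter_true_of_mem fun B _ => by omega]
  nlinarith

end Antichain

section Frameproof

variable {n : ℕ} {Q : Type*}

lemma IsWFP2.exists_agree_ne {C : Finset (Fin n → Q)} (hC : IsWFP2 C) {x y z : Fin n → Q}
    (hx : x ∈ C) (hy : y ∈ C) (hz : z ∈ C) (hzx : z ≠ x) (hzy : z ≠ y) :
    ∃ i, x i = y i ∧ z i ≠ x i := by
  classical
  by_contra! h
  have hmem : z ∈ wdesc {x, y} ∩ (C : Set (Fin n → Q)) := by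
    refine ⟨fun i hi w hw => ?_, hz⟩
    have hxy : x i = y i := hi x (by simp) y (by simp)
    rw [h i hxy]
    exact hi x (by simp) w hw
  rw [hC {x, y} (by simp [insert_subset_iff, hx, hy]) (by simp) card_le_two] at hmem
  simp [hzx, hzy] at hmem

open Classical in
/-- The set of positions in which two words differ. -/
noncomputable def diffSet (x y : Fin n → Q) : Finset (Fin n) := {i | y i ≠ x i}

lemma mem_diffSet {x y : Fin n → Q} {i : Fin n} : i ∈ diffSet x y ↔ y i ≠ x i := by
  simp [diffSet]

open Classical in
/-- The difference sets of a fixed word with all other words of a code. -/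
noncomputable def diffFamily (C : Finset (Fin n → Q)) (x : Fin n → Q) : Finset (Finset (Fin n)) :=
  (C.erase x).image (diffSet x)

lemma mem_diffFamily {C : Finset (Fin n → Q)} {x : Fin n → Q} {B : Finset (Fin n)} :
    B ∈ diffFamily C x ↔ ∃ y ∈ C, y ≠ x ∧ diffSet x y = B := by
  simp only [diffFamily, mem_image, mem_erase]
  grind

lemma IsWFP2.eq_of_diffSet_subset {C : Finset (Fin n → Q)} (hC : IsWFP2 C) {x y z : Fin n → Q}
    (hx : x ∈ C) (hy : y ∈ C) (hz : z ∈ C) (hyx : y ≠ x) (h : diffSet x y ⊆ diffSet x z) :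
    y = z := by
  by_contra hyz
  obtain ⟨i, hi, hi'⟩ := hC.exists_agree_ne hx hz hy hyx hyz
  exact mem_diffSet.1 (h (mem_diffSet.2 hi')) hi.symm

lemma IsWFP2.isAntichain_diffFamily {C : Finset (Fin n → Q)} (hC : IsWFP2 C) {x : Fin n → Q}
    (hx : x ∈ C) : IsAntichain (· ⊆ ·) (diffFamily C x : Set (Finset (Fin n))) := by
  intro A hA B hB hAB hsub
  obtain ⟨y, hy, hyx, rfl⟩ := mem_diffFamily.1 hA
  obtain ⟨z, hz, -, rfl⟩ := mem_diffFamily.1 hB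
  exact hAB (by rw [hC.eq_of_diffSet_subset hx hy hz hyx hsub])

lemma IsWFP2.card_diffFamily {C : Finset (Fin n → Q)} (hC : IsWFP2 C) {x : Fin n → Q}
    (hx : x ∈ C) : #(diffFamily C x) + 1 = #C := by
  classical
  rw [diffFamily, card_image_of_injOn, card_erase_add_one hx]
  intro y hy z hz h
  rw [mem_coe, mem_erase] at hy hz
  exact hC.eq_of_diffSet_subset hx hy.2 hz.2 hy.1 h.subset

lemma IsWFP2.not_disjoint_of_mem_diffFamily {C : Finset (Fin n → Q)} (hC : IsWFP2 C)
    {x : Fin n → Q} (hx : x ∈ C) {A B : Finset (Fin n)} (hA : A ∈ diffFamily C x)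
    (hB : B ∈ diffFamily C x) : ¬ Disjoint A B := by
  obtain ⟨y, hy, hyx, rfl⟩ := mem_diffFamily.1 hA
  obtain ⟨z, hz, hzx, rfl⟩ := mem_diffFamily.1 hB
  obtain ⟨i, hi, hi'⟩ := hC.exists_agree_ne hy hz hx hyx.symm hzx.symm
  rw [not_disjoint_iff]
  exact ⟨i, mem_diffSet.2 hi'.symm, mem_diffSet.2 (hi ▸ hi'.symm)⟩

lemma symmDiff_diffSet_subset (x y z : Fin n → Q) :
    symmDiff (diffSet x y) (diffSet x z) ⊆ diffSet y z := by
  intro i hi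
  simp only [mem_symmDiff, mem_diffSet] at hi ⊢
  grind

lemma two_mul_le_card_symmDiff {α : Type*} [Fintype α] [DecidableEq α] {k : ℕ}
    (hα : Fintype.card α = 2 * k + 1) {A B : Finset α}
    (hA : #A = k + 1) (hB : #B = k + 1) (h : Aᶜ ⊆ B) : 2 * k ≤ #(symmDiff A B) := by
  have hunion : A ∪ B = univ := by
    rw [eq_univ_iff_forall]
    intro i
    by_cases hi : i ∈ A
    · exact mem_union_left _ hi
    · exact mem_union_right _ (h (mem_compl.2 hi))
  have h₁ := card_union_add_card_inter A B
  rw [hunion, card_univ, hα, hA, hB] at h₁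
  have h₂ : #(symmDiff A B) = #(A \ B) + #(B \ A) := by
    rw [← card_union_of_disjoint disjoint_sdiff_sdiff]
    rfl
  have h₃ := card_sdiff_add_card_inter A B
  have h₄ := card_sdiff_add_card_inter B A
  rw [inter_comm] at h₄
  omega

/-- Either two words differ in at least `2 * k` positions, and then the antichain based at one of
them is small, or the antichain based at any word misses half of the layer `k + 1`. -/
lemma IsWFP2.card_bound {k : ℕ} (hk : 0 < k) {C : Finset (Fin (2 * k + 1) → Q)} (hC : IsWFP2 C)
    {x : Fin (2 * k + 1) → Q} (hx : x ∈ C) :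
    (2 * k + 1) * #C + (2 * k + 1).choose k ≤
        (2 * k + 1) * (2 * k + 1).choose k + 2 * (2 * k + 1) ∨
      2 * (k + 2) * #C ≤ (2 * k + 3) * (2 * k + 1).choose k + 2 * (k + 2) := by
  have hα : Fintype.card (Fin (2 * k + 1)) = 2 * k + 1 := Fintype.card_fin _
  by_cases hfar : ∃ y ∈ C, ∃ z ∈ C, z ≠ y ∧ 2 * k ≤ #(diffSet y z)
  · left
    obtain ⟨y, hy, z, hz, hzy, hcard⟩ := hfar
    have := (hC.isAntichain_diffFamily hy).mul_card_le_of_two_mul_le hk hα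
      (mem_diffFamily.2 ⟨z, hz, hzy, rfl⟩) hcard
    rw [← hC.card_diffFamily hy]
    linarith
  · right
    have := card_le_of_intersecting_of_forall_not_compl_subset hk hα
      (hC.isAntichain_diffFamily hx)
      (fun A hA B hB => hC.not_disjoint_of_mem_diffFamily hx hA hB)
      (fun A hA B hB hAk hBk hsub => by
        have h2k := two_mul_le_card_symmDiff hα hAk hBk hsub
        obtain ⟨y, hy, -, rfl⟩ := mem_diffFamily.1 hA
        obtain ⟨z, hz, -, rfl⟩ := mem_diffFamily.1 hB
        have hle := h2k.trans (card_le_card (symmDiff_diffSet_subset x y z))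
        refine hfar ⟨y, hy, z, hz, ?_, hle⟩
        rintro rfl
        rw [symmDiff_self, bot_eq_empty, card_empty] at h2k
        omega)
    rw [← hC.card_diffFamily hx]
    linarith

end Frameproof

/-- For odd `n ≥ 7` with `n ≡ 1 (mod 4)`, an `(n,m,q)` wide-sense 2-frameproof code
satisfies `m ≤ C(n, (n-1)/2) - (n² - 9)/8 - ⌊(n-5)²/64⌋`. -/
theorem wfp2_upper_bound_odd_one_mod_four {n m q : ℕ} {Q : Type*} [Fintype Q]
    (hq : Fintype.card Q = q) (hq2 : 2 ≤ q)
    (hodd : Odd n) (hn7 : 7 ≤ n) (hmod : n % 4 = 1)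
    (C : Finset (Fin n → Q)) (hC : C.card = m) (hwfp : IsWFP2 C) :
    m + (n ^ 2 - 9) / 8 + (n - 5) ^ 2 / 64 ≤ n.choose ((n - 1) / 2) := by
  obtain ⟨k, rfl⟩ : ∃ k, n = 2 * k + 1 := hodd
  have hk : 4 ≤ k := by omega
  have hcubic := cubic_lt_choose_half hk
  have ha := Nat.div_mul_le_self ((2 * k + 1) ^ 2 - 9) 8
  have hb := Nat.div_mul_le_self ((2 * k + 1 - 5) ^ 2) 64
  rw [show (2 * k + 1 - 1) / 2 = k by omega]
  set a := ((2 * k + 1) ^ 2 - 9) / 8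
  set b := (2 * k + 1 - 5) ^ 2 / 64
  set N := (2 * k + 1).choose k
  have hs : 16 * (a + b) + 12 ≤ 9 * k ^ 2 + 4 * k := by
    obtain ⟨j, rfl⟩ := Nat.exists_eq_add_of_le hk
    rw [show (2 * (4 + j) + 1) ^ 2 - 9 = 4 * j ^ 2 + 36 * j + 72 from
      Nat.sub_eq_of_eq_add (by ring)] at ha
    rw [show 2 * (4 + j) + 1 - 5 = 2 * j + 4 by omega] at hb
    nlinarith
  have hs₁ : 2 * (k + 2) * (a + b) < N := by nlinarith
  have hs₂ : (2 * k + 1) * (a + b + 1) < N := by nlinarith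
  rcases C.eq_empty_or_nonempty with rfl | ⟨x, hx⟩
  · rw [card_empty] at hC
    nlinarith
  · by_contra! hlt
    rcases hwfp.card_bound (by omega) hx with h | h <;> rw [hC] at h <;> nlinarith
end

section
/- Let n ≥ 6 be even and let F be a nonempty non 2-covering Sperner family of subsets of [n]. If the maximum size u of a member of F satisfies u ≥ n/2 + 1, then |F| ≤ (n choose n/2 − 1) − n/2. -/
/-- A family of subsets is a Sperner family (antichain): no member is a subset of
another member unless they are equal. -/
def IsSperner {n : ℕ} (F : Finset (Finset (Fin n))) : Prop :=
  ∀ A ∈ F, ∀ B ∈ F, A ⊆ B → A = B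

/-- A family is non 2-covering if no two (not necessarily distinct) members
have union equal to the whole ground set. -/
def NonTwoCovering {n : ℕ} (F : Finset (Finset (Fin n))) : Prop :=
  ∀ A ∈ F, ∀ B ∈ F, A ∪ B ≠ Finset.univ

open Finset Finset.Colex
open scoped FinsetFamily

/-- The number of members of a uniform family on `X` containing a given set one smaller. -/
lemma card_filter_superset_le {α : Type*} [DecidableEq α] {𝒜 : Finset (Finset α)} {r : ℕ}
    {X C : Finset α} (h𝒜 : (𝒜 : Set (Finset α)).Sized (r + 1)) (hX : ∀ A ∈ 𝒜, A ⊆ X)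
    (hCX : C ⊆ X) (hC : #C = r) : #{A ∈ 𝒜 | C ⊆ A} ≤ #X - r := by
  have hsub : {A ∈ 𝒜 | C ⊆ A} ⊆ (X \ C).image (fun a => insert a C) := by
    intro A hA
    obtain ⟨hA, hCA⟩ := mem_filter.1 hA
    have hcard : #(A \ C) = 1 := by
      rw [card_sdiff_of_subset hCA, h𝒜 hA, hC]; omega
    obtain ⟨a, ha⟩ := card_eq_one.1 hcard
    have haA : a ∈ A \ C := by simp [ha]
    refine mem_image.2 ⟨a, sdiff_subset_sdiff (hX A hA) Subset.rfl haA, ?_⟩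
    rw [insert_eq, ← ha, sdiff_union_of_subset hCA]
  calc _ ≤ #(X \ C) := (card_le_card hsub).trans card_image_le
    _ = #X - r := by rw [card_sdiff_of_subset hCX, hC]

/-- The number of members of the shadow below a given set of the family. -/
lemma card_le_card_filter_shadow {α : Type*} [DecidableEq α] {𝒜 : Finset (Finset α)}
    {A : Finset α} (hA : A ∈ 𝒜) : #A ≤ #{C ∈ ∂ 𝒜 | C ⊆ A} := by
  rw [← card_image_of_injOn A.erase_injOn]
  refine card_le_card fun C hC => ?_
  obtain ⟨a, ha, rfl⟩ := mem_image.1 hC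
  exact mem_filter.2 ⟨erase_mem_shadow hA ha, erase_subset _ _⟩

/-- Local LYM inequality on a ground set of size at most `2 * r + 1`. -/
lemma card_le_card_shadow_of_subset {α : Type*} [DecidableEq α] {𝒜 : Finset (Finset α)} {r : ℕ}
    {X : Finset α} (h𝒜 : (𝒜 : Set (Finset α)).Sized (r + 1)) (hX : ∀ A ∈ 𝒜, A ⊆ X)
    (hr : #X ≤ 2 * r + 1) : #𝒜 ≤ #(∂ 𝒜) := by
  have h : #𝒜 * (r + 1) ≤ #(∂ 𝒜) * (r + 1) := by
    refine card_mul_le_card_mul (fun A C => C ⊆ A) (fun A hA => ?_) (fun C hC => ?_)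
    · exact (h𝒜 hA).symm.trans_le (card_le_card_filter_shadow hA)
    · obtain ⟨A, hA, hCA⟩ := exists_subset_of_mem_shadow hC
      exact (card_filter_superset_le h𝒜 hX (hCA.trans (hX A hA)) (h𝒜.shadow hC)).trans (by omega)
  exact Nat.le_of_mul_le_mul_right h r.succ_pos

/-- A nonempty family of `(r + 1)`-sets above the middle layer gains at least `r` members when
passing to its shadow. -/
lemma card_add_le_card_shadow_s3 {α : Type*} [DecidableEq α] [Fintype α] {𝒜 : Finset (Finset α)}
    {r : ℕ} (h𝒜 : (𝒜 : Set (Finset α)).Sized (r + 1)) (hne : 𝒜.Nonempty)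
    (hr : Fintype.card α ≤ 2 * r) : #𝒜 + r ≤ #(∂ 𝒜) := by
  obtain ⟨A, hA⟩ := hne
  have hAr : #A = r + 1 := h𝒜 hA
  let 𝒮 := A.image A.erase
  have h𝒮 : #𝒮 = r + 1 := by rw [card_image_of_injOn A.erase_injOn, hAr]
  have h𝒮sub : 𝒮 ⊆ ∂ 𝒜 := by
    intro C hC
    obtain ⟨a, ha, rfl⟩ := mem_image.1 hC
    exact erase_mem_shadow hA ha
  have hcard : #(𝒜.erase A) * r ≤ #(∂ 𝒜 \ 𝒮) * r := by
    refine card_mul_le_card_mul (fun B C => C ⊆ B) (fun B hB => ?_) (fun C hC => ?_)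
    · obtain ⟨hBA, hB⟩ := mem_erase.1 hB
      have hBr : #B = r + 1 := h𝒜 hB
      have hsub : {C ∈ ∂ 𝒜 | C ⊆ B}.erase (A ∩ B) ⊆ (∂ 𝒜 \ 𝒮).bipartiteAbove
          (fun B C => C ⊆ B) B := by
        intro C hC
        obtain ⟨hCne, hC⟩ := mem_erase.1 hC
        obtain ⟨hC, hCB⟩ := mem_filter.1 hC
        refine (mem_bipartiteAbove _).2 ⟨mem_sdiff.2 ⟨hC, fun hCS => hCne ?_⟩, hCB⟩
        obtain ⟨a, ha, rfl⟩ := mem_image.1 hCS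
        refine eq_of_subset_of_card_le (subset_inter (erase_subset _ _) hCB) ?_
        rw [card_erase_of_mem ha, hAr]
        by_contra! hlt
        have h1 : A ∩ B = A := eq_of_subset_of_card_le inter_subset_left (by omega)
        have h2 : A = B := eq_of_subset_of_card_le (inter_eq_left.1 h1) (by omega)
        exact hBA h2.symm
      have h1 := card_le_card hsub
      have h2 := card_le_card_filter_shadow hB
      have h3 := pred_card_le_card_erase (s := {C ∈ ∂ 𝒜 | C ⊆ B}) (a := A ∩ B)
      omega
    · have hC : C ∈ ∂ 𝒜 := (mem_sdiff.1 hC).1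
      refine (card_filter_superset_le (X := univ) (r := r) (fun B hB => h𝒜 (mem_of_mem_erase hB))
        (fun B _ => subset_univ B) (subset_univ C) (h𝒜.shadow hC)).trans ?_
      rw [card_univ]; omega
  rcases r.eq_zero_or_pos with rfl | hr0
  · have : IsEmpty α := Fintype.card_eq_zero_iff.1 (by omega)
    simp [eq_empty_of_isEmpty A] at hAr
  have h1 := Nat.le_of_mul_le_mul_right hcard hr0
  rw [card_erase_of_mem hA, card_sdiff_of_subset h𝒮sub, h𝒮] at h1
  have h2 := card_le_card h𝒮sub
  have h3 := card_pos.2 ⟨A, hA⟩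
  omega

/-- Every colex initial segment contains initial segments of all smaller sizes. -/
lemma exists_isInitSeg_subset_card_eq {α : Type*} [LinearOrder α] {𝒜 : Finset (Finset α)}
    {r k : ℕ} (h𝒜 : IsInitSeg 𝒜 r) (hk : k ≤ #𝒜) : ∃ ℬ ⊆ 𝒜, IsInitSeg ℬ r ∧ #ℬ = k := by
  induction hk using Nat.decreasingInduction with
  | self => exact ⟨𝒜, Subset.rfl, h𝒜, rfl⟩
  | of_succ k _ ih =>
    obtain ⟨ℬ, hsub, hℬ, hcard⟩ := ih
    obtain ⟨s, hs, hmax⟩ := ℬ.exists_max_image toColex (card_pos.1 (by omega))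
    refine ⟨ℬ.erase s, (erase_subset _ _).trans hsub,
      ⟨fun t ht => hℬ.1 (mem_of_mem_erase ht), fun t u ht hu => ?_⟩, ?_⟩
    · have htℬ := mem_of_mem_erase ht
      refine mem_erase.2 ⟨?_, hℬ.2 htℬ hu⟩
      rintro rfl
      exact (hmax t htℬ).not_gt hu.1
    · rw [card_erase_of_mem hs, hcard]; rfl

/-- The `r`-subsets of a strict lower section form a colex initial segment. -/
lemma isInitSeg_powersetCard_Iio {α : Type*} [LinearOrder α] [LocallyFiniteOrderBot α] (a : α)
    (r : ℕ) : IsInitSeg (powersetCard r (Iio a)) r := by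
  refine ⟨Set.sized_powersetCard _ _, fun s t hs ht => ?_⟩
  obtain ⟨hs, -⟩ := mem_powersetCard.1 hs
  refine mem_powersetCard.2 ⟨fun b hb => mem_Iio.2 ?_, ht.2⟩
  exact forall_lt_mono ht.1.le (fun c hc => mem_Iio.1 (hs hc)) b hb

/-- An intersecting family of `(r + 1)`-sets on `2 * r + 2` points does not shrink when passing to
its shadow. -/
lemma card_le_card_shadow_of_intersecting {n r : ℕ} (hn : n = 2 * r + 2)
    {𝒜 : Finset (Finset (Fin n))} (h𝒜 : (𝒜 : Set (Finset (Fin n))).Sized (r + 1))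
    (hint : (𝒜 : Set (Finset (Fin n))).Intersecting) : #𝒜 ≤ #(∂ 𝒜) := by
  subst hn
  have hIio : #(Iio (Fin.last (2 * r + 1))) = 2 * r + 1 := by simp
  have hcard : #𝒜 ≤ (2 * r + 1).choose (r + 1) := by
    have hdisj : Disjoint 𝒜 𝒜ᶜˢ := disjoint_left.2 fun A hA hAc =>
      hint hA (mem_compls.1 hAc) disjoint_compl_right
    have hsub : 𝒜 ∪ 𝒜ᶜˢ ⊆ powersetCard (r + 1) univ := by
      refine union_subset (subset_powersetCard_univ_iff.2 h𝒜) fun A hA =>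
        mem_powersetCard_univ.2 ?_
      have h1 : #Aᶜ = r + 1 := h𝒜 (mem_compls.1 hA)
      have h2 := card_compl_add_card A
      rw [Fintype.card_fin] at h2
      omega
    have h1 := card_le_card hsub
    rw [card_union_of_disjoint hdisj, card_compls, card_powersetCard, card_univ,
      Fintype.card_fin] at h1
    have h2 : (2 * r + 2).choose (r + 1) = (2 * r + 1).choose r + (2 * r + 1).choose (r + 1) :=
      Nat.choose_succ_succ _ _
    have h3 := Nat.choose_symm_half r
    omega
  obtain ⟨ℬ, hsub, hℬ, hℬ𝒜⟩ := exists_isInitSeg_subset_card_eq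
    (isInitSeg_powersetCard_Iio (Fin.last (2 * r + 1)) (r + 1)) (k := #𝒜)
    (by rwa [card_powersetCard, hIio])
  calc #𝒜 = #ℬ := hℬ𝒜.symm
    _ ≤ #(∂ ℬ) := card_le_card_shadow_of_subset hℬ.1
        (fun B hB => (mem_powersetCard.1 (hsub hB)).1) hIio.le
    _ ≤ #(∂ 𝒜) := kruskal_katona h𝒜 hℬ𝒜.le hℬ

/-- An antichain whose members have at most `r ≤ n / 2` elements has at most `n.choose r`
members. -/
lemma IsSperner.card_le_choose {n r : ℕ} {F : Finset (Finset (Fin n))} (hS : IsSperner F)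
    (hF : ∀ A ∈ F, #A ≤ r) (hr : r ≤ n / 2) : #F ≤ n.choose r := by
  have hanti : IsAntichain (· ⊆ ·) (F : Set (Finset (Fin n))) :=
    fun A hA B hB hAB h => hAB (hS A hA B hB h)
  have hlym := lubell_yamamoto_meshalkin_inequality_sum_inv_choose (𝕜 := ℚ) hanti
  rw [Fintype.card_fin] at hlym
  have hpos : (0 : ℚ) < n.choose r := by
    exact_mod_cast Nat.choose_pos (by omega)
  have hle : ∑ _A ∈ F, (n.choose r : ℚ)⁻¹ ≤ ∑ A ∈ F, (n.choose #A : ℚ)⁻¹ := by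
    refine sum_le_sum fun A hA => ?_
    have h1 : 0 < n.choose #A := Nat.choose_pos ((hF A hA).trans (by omega))
    have h2 : n.choose #A ≤ n.choose r := by
      have hmono : ∀ i j, i ≤ j → j ≤ n / 2 → n.choose i ≤ n.choose j := by
        intro i j hij
        induction hij with
        | refl => exact fun _ => le_rfl
        | step h ih => exact fun hj => (ih (by omega)).trans (Nat.choose_le_succ_of_lt_half_left
            (by omega))
      exact hmono _ _ (hF A hA) hr
    gcongr
  have h := hle.trans hlym
  rw [sum_const, nsmul_eq_mul, ← div_eq_mul_inv, div_le_one hpos] at h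
  exact_mod_cast h

/-- Replace the members of size `r` by their shadow. -/
def pushDown {n : ℕ} (F : Finset (Finset (Fin n))) (r : ℕ) : Finset (Finset (Fin n)) :=
  F \ F.slice r ∪ ∂ (F.slice r)

section pushDown

variable {n r : ℕ} {F : Finset (Finset (Fin n))}

lemma exists_superset_of_mem_pushDown {C : Finset (Fin n)} (hC : C ∈ pushDown F r) :
    ∃ A ∈ F, C ⊆ A := by
  rcases mem_union.1 hC with hC | hC
  · exact ⟨C, (mem_sdiff.1 hC).1, Subset.rfl⟩
  · obtain ⟨A, hA, hCA⟩ := exists_subset_of_mem_shadow hC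
    exact ⟨A, (mem_slice.1 hA).1, hCA⟩

lemma nonTwoCovering_pushDown (hc : NonTwoCovering F) : NonTwoCovering (pushDown F r) := by
  intro C hC D hD h
  obtain ⟨A, hA, hCA⟩ := exists_superset_of_mem_pushDown hC
  obtain ⟨B, hB, hDB⟩ := exists_superset_of_mem_pushDown hD
  exact hc A hA B hB (univ_subset_iff.1 (h ▸ union_subset_union hCA hDB))

lemma card_le_of_mem_pushDown (hF : ∀ A ∈ F, #A ≤ r + 1) :
    ∀ C ∈ pushDown F (r + 1), #C ≤ r := by
  intro C hC
  rcases mem_union.1 hC with hC | hC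
  · obtain ⟨hC, hCr⟩ := mem_sdiff.1 hC
    have h1 := hF C hC
    have h2 : #C ≠ r + 1 := fun h => hCr (mem_slice.2 ⟨hC, h⟩)
    omega
  · exact (sized_slice.shadow hC).le

lemma IsSperner.not_subset_of_mem_shadow (hS : IsSperner F) {B C : Finset (Fin n)} (hB : B ∈ F)
    (hC : C ∈ ∂ (F.slice r)) : ¬ B ⊆ C := by
  intro hBC
  obtain ⟨A, hA, a, ha, rfl⟩ := mem_shadow_iff.1 hC
  have hAB := hS B hB A (mem_slice.1 hA).1 (hBC.trans (erase_subset _ _))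
  exact notMem_erase a A (hBC (hAB ▸ ha))

lemma isSperner_pushDown (hS : IsSperner F) (hF : ∀ A ∈ F, #A ≤ r + 1) :
    IsSperner (pushDown F (r + 1)) := by
  intro C hC D hD hCD
  have hDr := card_le_of_mem_pushDown hF D hD
  rcases mem_union.1 hC with hC | hC
  · rcases mem_union.1 hD with hD | hD
    · exact hS C (mem_sdiff.1 hC).1 D (mem_sdiff.1 hD).1 hCD
    · exact absurd hCD (hS.not_subset_of_mem_shadow (mem_sdiff.1 hC).1 hD)
  · exact eq_of_subset_of_card_le hCD (hDr.trans (sized_slice.shadow hC).ge)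

lemma card_pushDown_add_card_slice (hS : IsSperner F) :
    #(pushDown F r) + #(F.slice r) = #F + #(∂ (F.slice r)) := by
  have hdisj : Disjoint (F \ F.slice r) (∂ (F.slice r)) := disjoint_left.2 fun C hC hC' =>
    hS.not_subset_of_mem_shadow (mem_sdiff.1 hC).1 hC' Subset.rfl
  have h := card_sdiff_add_card_eq_card (slice_subset (𝒜 := F) (r := r))
  rw [pushDown, card_union_of_disjoint hdisj]
  omega

end pushDown

/-- Milner's bound for a non 2-covering antichain with no member above the middle layer. -/
lemma IsSperner.card_le_choose_of_nonTwoCovering {n r : ℕ} (hn : n = 2 * r + 2)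
    {F : Finset (Finset (Fin n))} (hS : IsSperner F) (hc : NonTwoCovering F)
    (hF : ∀ A ∈ F, #A ≤ r + 1) : #F ≤ n.choose r := by
  have hint : (F.slice (r + 1) : Set (Finset (Fin n))).Intersecting := by
    intro A hA B hB hAB
    obtain ⟨hA, hAr⟩ := mem_slice.1 hA
    obtain ⟨hB, hBr⟩ := mem_slice.1 hB
    refine hc A hA B hB (card_eq_iff_eq_univ _ |>.1 ?_)
    rw [card_union_of_disjoint hAB, hAr, hBr, Fintype.card_fin]
    omega
  have h1 := card_le_card_shadow_of_intersecting hn sized_slice hint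
  have h2 := card_pushDown_add_card_slice hS (r := r + 1)
  have h3 := (isSperner_pushDown hS hF).card_le_choose (card_le_of_mem_pushDown hF) (by omega)
  omega

/-- Milner's bound for a non 2-covering antichain on an even number of points, improved when some
member lies above the middle layer. -/
lemma IsSperner.card_add_le_choose {n r : ℕ} (hn : n = 2 * r + 2) (k : ℕ)
    {F : Finset (Finset (Fin n))} (hS : IsSperner F) (hc : NonTwoCovering F)
    (hF : ∀ A ∈ F, #A ≤ r + 1 + k) :
    #F + (if ∃ A ∈ F, r + 1 < #A then r + 1 else 0) ≤ n.choose r := by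
  induction k generalizing F with
  | zero =>
    rw [if_neg (by rintro ⟨A, hA, h⟩; exact absurd (hF A hA) (by omega))]
    exact hS.card_le_choose_of_nonTwoCovering hn hc hF
  | succ k ih =>
    have h1 := ih (isSperner_pushDown (r := r + 1 + k) hS hF) (nonTwoCovering_pushDown hc)
      (card_le_of_mem_pushDown hF)
    rcases (F.slice (r + 1 + k + 1)).eq_empty_or_nonempty with hemp | hne
    · have h : pushDown F (r + 1 + k + 1) = F := by simp [pushDown, hemp]
      rwa [h] at h1
    · have h2 := card_add_le_card_shadow_s3 sized_slice hne (by rw [Fintype.card_fin]; omega)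
      have h3 := card_pushDown_add_card_slice hS (r := r + 1 + k + 1)
      split_ifs <;> omega

/-- For even `n ≥ 6`, a nonempty non 2-covering Sperner family whose maximum member
size `u` satisfies `u ≥ n/2 + 1` has `|F| ≤ C(n, n/2 - 1) - n/2`. -/
theorem non_two_covering_sperner_max_large {n u : ℕ} (hn : Even n) (hn6 : 6 ≤ n)
    (F : Finset (Finset (Fin n))) (hne : F.Nonempty)
    (hS : IsSperner F) (hc : NonTwoCovering F)
    (humax : ∀ A ∈ F, A.card ≤ u) (huatt : ∃ A ∈ F, A.card = u)
    (hu : n / 2 + 1 ≤ u) :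
    F.card + n / 2 ≤ n.choose (n / 2 - 1) := by
  obtain ⟨m, hm⟩ := hn
  have h := hS.card_add_le_choose (r := n / 2 - 1) (by omega) u hc
    (fun A hA => (humax A hA).trans (by omega))
  obtain ⟨A, hA, hAu⟩ := huatt
  rw [if_pos ⟨A, hA, by omega⟩] at h
  omega
end

section
/- Let n be odd with n ≥ 7 and let F be a non 2-covering Sperner family of subsets of [n] such that every member A ∈ F satisfies |A| ≥ (n+1)/2. Then |F| ≤ (n choose (n+3)/2). -/
open Finset in
/-- An antichain of sets of size at least `k` has at most as many members as its shadow on level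
`k`, provided that `k` is a largest level of the Boolean lattice. -/
theorem card_le_card_falling {α : Type*} [Fintype α] [DecidableEq α] {k : ℕ}
    {𝒜 : Finset (Finset α)} (h𝒜 : IsAntichain (· ⊆ ·) (𝒜 : Set (Finset α)))
    (hsize : ∀ A ∈ 𝒜, k ≤ #A) (hk : k ≤ Fintype.card α)
    (hmax : ∀ r, (Fintype.card α).choose r ≤ (Fintype.card α).choose k) :
    #𝒜 ≤ #(falling k 𝒜) := by
  have hpos : (0 : ℚ) < (Fintype.card α).choose k := by exact_mod_cast Nat.choose_pos hk
  have hlym := le_card_falling_div_choose (𝕜 := ℚ) (Nat.sub_le (Fintype.card α) k) h𝒜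
  rw [Nat.sub_sub_self hk] at hlym
  have hcard : #𝒜 = ∑ r ∈ range (Fintype.card α - k + 1), #(𝒜 # (Fintype.card α - r)) := by
    rw [card_eq_sum_card_fiberwise (f := fun A => Fintype.card α - #A)
      (t := range (Fintype.card α - k + 1))]
    · refine sum_congr rfl fun r hr => congrArg card (filter_congr fun A _ => ?_)
      have := card_le_univ A
      rw [mem_range] at hr
      lia
    · intro A hA
      have := hsize A hA
      simp only [coe_range, Set.mem_Iio]
      lia
  have hle : (#𝒜 : ℚ) / (Fintype.card α).choose k ≤
      #(falling k 𝒜) / (Fintype.card α).choose k := by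
    refine le_trans ?_ hlym
    rw [hcard, Nat.cast_sum, sum_div]
    refine sum_le_sum fun r _ => ?_
    have : (0 : ℚ) < (Fintype.card α).choose (Fintype.card α - r) := by
      exact_mod_cast Nat.choose_pos (Nat.sub_le _ _)
    gcongr
    exact hmax _
  exact_mod_cast (div_le_div_iff_of_pos_right hpos).1 hle

open Finset in
/-- Members of a shadow of a non 2-covering family have pairwise intersecting complements. -/
theorem NonTwoCovering.intersecting_compls_falling {n : ℕ} {F : Finset (Finset (Fin n))}
    (hF : NonTwoCovering F) (k : ℕ) :
    ((falling k F).compls : Set (Finset (Fin n))).Intersecting := by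
  intro A hA B hB hAB
  rw [mem_coe, mem_compls, mem_falling] at hA hB
  obtain ⟨⟨S, hS, hAS⟩, -⟩ := hA
  obtain ⟨⟨T, hT, hBT⟩, -⟩ := hB
  refine hF S hS T hT (univ_subset_iff.1 ?_)
  calc univ = Aᶜ ∪ Bᶜ := by rw [← compl_inter, disjoint_iff_inter_eq_empty.1 hAB, compl_empty]
    _ ⊆ S ∪ T := union_subset_union hAS hBT

/-- For odd `n ≥ 7`, a non 2-covering Sperner family all of whose members have
size at least `(n+1)/2` has `|F| ≤ C(n, (n+3)/2)`. -/
theorem non_two_covering_sperner_large_sets {n : ℕ} (hodd : Odd n) (hn7 : 7 ≤ n)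
    (F : Finset (Finset (Fin n)))
    (hS : IsSperner F) (hc : NonTwoCovering F)
    (hsize : ∀ A ∈ F, (n + 1) / 2 ≤ A.card) :
    F.card ≤ n.choose ((n + 3) / 2) := by
  obtain ⟨m, rfl⟩ := hodd
  rw [show (2 * m + 1 + 1) / 2 = m + 1 by lia] at hsize
  have hfall : F.card ≤ (Finset.falling (m + 1) F).card := by
    refine card_le_card_falling (fun A hA B hB hne hAB => hne (hS A hA B hB hAB)) hsize
      (by rw [Fintype.card_fin]; lia) fun r => ?_
    rw [Fintype.card_fin, Nat.choose_symm_half]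
    simpa [show (2 * m + 1) / 2 = m by lia] using Nat.choose_le_middle r (2 * m + 1)
  have hsized : ((Finset.falling (m + 1) F).compls : Set (Finset (Fin (2 * m + 1)))).Sized m := by
    have h := (Finset.sized_falling (m + 1) F).compls
    rwa [Fintype.card_fin, show 2 * m + 1 - (m + 1) = m by lia] at h
  have hekr := Finset.erdos_ko_rado (hc.intersecting_compls_falling (m + 1)) hsized (by lia)
  rw [Finset.card_compls] at hekr
  calc F.card ≤ (2 * m + 1 - 1).choose (m - 1) := hfall.trans hekr
    _ ≤ (2 * m + 1).choose (m - 1) := Nat.choose_le_choose _ (Nat.sub_le _ _)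
    _ = (2 * m + 1).choose ((2 * m + 1 + 3) / 2) :=
      Nat.choose_symm_of_eq_add (by lia)
end

section
/- Let n be odd with n ≥ 7, let q ≥ 2, and let C = {c^1,…,c^m} be an (n,m,q) wide-sense 2-frameproof code. If there exists an index i ∈ {1,…,m} such that |I(i,j)| ≤ (n−1)/2 for every j ≠ i, then m ≤ (n choose (n+3)/2) + 1. -/
/-- The coincidence set of two words: the set of positions where they agree. -/
def coin {n : ℕ} {Q : Type*} [DecidableEq Q] (x y : Fin n → Q) : Finset (Fin n) :=
  Finset.univ.filter fun k => x k = y k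

open Finset in
open scoped FinsetFamily in
/-- A weighting of a uniform family that vanishes on all up-sets generated by members of the
shadow vanishes on the up-set generated by any smaller set. -/
theorem sum_superset_eq_zero_of_shadow {α : Type*} [DecidableEq α] [Fintype α] {k : ℕ}
    {ℱ : Finset (Finset α)} (hℱ : (ℱ : Set (Finset α)).Sized k) (v : ℱ → ℚ)
    (hv : ∀ S ∈ ∂ ℱ, ∑ A : ℱ, (if S ⊆ A.1 then v A else 0) = 0) (d : ℕ) :
    ∀ S : Finset α, #S + d + 1 = k → ∑ A : ℱ, (if S ⊆ A.1 then v A else 0) = 0 := by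
  induction d with
  | zero =>
    intro S hS
    by_cases hmem : S ∈ ∂ ℱ
    · exact hv S hmem
    · refine sum_eq_zero fun A _ => if_neg fun hSA => hmem ?_
      exact mem_shadow_iff_exists_mem_card_add_one.2
        ⟨A.1, A.2, hSA, by have := hℱ A.2; omega⟩
  | succ d ih =>
    intro S hS
    have hinner : ∀ A : ℱ, ∑ x ∈ Sᶜ, (if insert x S ⊆ A.1 then v A else 0)
        = (d + 2 : ℚ) * (if S ⊆ A.1 then v A else 0) := by
      intro A
      by_cases hSA : S ⊆ A.1
      · have hcard : #(A.1 \ S) = d + 2 := by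
          have := card_sdiff_of_subset hSA
          have := hℱ A.2
          omega
        have hfilter : Sᶜ.filter (fun x => insert x S ⊆ A.1) = A.1 \ S := by
          ext x
          simp only [mem_filter, mem_compl, insert_subset_iff, mem_sdiff]
          tauto
        rw [← sum_filter, hfilter, sum_const, hcard, if_pos hSA, nsmul_eq_mul]
        push_cast
        ring
      · rw [if_neg hSA, mul_zero]
        exact sum_eq_zero fun x _ => if_neg fun h => hSA ((subset_insert x S).trans h)
    have hzero : (d + 2 : ℚ) * ∑ A : ℱ, (if S ⊆ A.1 then v A else 0) = 0 := by
      rw [mul_sum, ← sum_congr rfl fun A _ => hinner A, sum_comm]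
      refine sum_eq_zero fun x hx => ih _ ?_
      rw [card_insert_of_notMem (mem_compl.1 hx)]
      omega
    exact (mul_eq_zero.1 hzero).resolve_left (by positivity)

open Finset in
open scoped FinsetFamily in
/-- **Katona's shadow theorem** for intersecting families: the shadow of an intersecting uniform
family is at least as large as the family. -/
theorem card_le_card_shadow_of_intersecting_s7 {α : Type*} [DecidableEq α] [Fintype α] {k : ℕ}
    {ℱ : Finset (Finset α)} (hℱ : (ℱ : Set (Finset α)).Sized k)
    (hint : ∀ A ∈ ℱ, ∀ B ∈ ℱ, (A ∩ B).Nonempty) : #ℱ ≤ #(∂ ℱ) := by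
  let W : (ℱ → ℚ) →ₗ[ℚ] ((∂ ℱ : Finset (Finset α)) → ℚ) :=
    { toFun := fun v S => ∑ A : ℱ, (if S.1 ⊆ A.1 then v A else 0)
      map_add' := by
        intro v w
        ext S
        simp only [Pi.add_apply, ← sum_add_distrib]
        refine sum_congr rfl fun A _ => ?_
        split_ifs <;> simp
      map_smul' := by
        intro a v
        ext S
        simp [mul_sum] }
  have hW : Function.Injective W := by
    rw [← LinearMap.ker_eq_bot, LinearMap.ker_eq_bot']
    intro v hv
    have hshadow : ∀ S ∈ ∂ ℱ, ∑ A : ℱ, (if S ⊆ A.1 then v A else 0) = 0 :=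
      fun S hS => congrFun hv ⟨S, hS⟩
    ext A₀
    have hsmall : ∀ S ∈ A₀.1.ssubsets, ∑ A : ℱ, (if S ⊆ A.1 then v A else 0) = 0 := by
      intro S hS
      have hlt := card_lt_card (mem_ssubsets.1 hS)
      rw [hℱ A₀.2] at hlt
      exact sum_superset_eq_zero_of_shadow hℱ v hshadow (k - #S - 1) S (by omega)
    have hpow : ∀ A : ℱ, ∑ S ∈ A₀.1.powerset, (-1 : ℚ) ^ #S * (if S ⊆ A.1 then v A else 0)
        = 0 := by
      intro A
      have halt : ∑ S ∈ (A₀.1 ∩ A.1).powerset, (-1 : ℚ) ^ #S = 0 := by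
        exact_mod_cast sum_powerset_neg_one_pow_card_of_nonempty (hint _ A₀.2 _ A.2)
      have hfilter : A₀.1.powerset.filter (fun S => S ⊆ A.1) = (A₀.1 ∩ A.1).powerset := by
        ext S
        simp only [mem_filter, mem_powerset, subset_inter_iff]
      simp only [mul_ite, mul_zero]
      rw [← sum_filter, hfilter, ← sum_mul, halt, zero_mul]
    have htop : ∑ A : ℱ, (if A₀.1 ⊆ A.1 then v A else 0) = v A₀ := by
      rw [sum_eq_single A₀]
      · simp
      · intro A _ hne
        refine if_neg fun hsub => hne (Subtype.ext ?_)
        exact (eq_of_subset_of_card_le hsub (by rw [hℱ A.2, hℱ A₀.2])).symm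
      · simp
    have htotal : ∑ S ∈ A₀.1.powerset, (-1 : ℚ) ^ #S * ∑ A : ℱ, (if S ⊆ A.1 then v A else 0)
        = 0 := by
      simp_rw [mul_sum]
      rw [sum_comm]
      exact sum_eq_zero fun A _ => hpow A
    rw [sum_eq_single_of_mem A₀.1 (mem_powerset_self _), htop] at htotal
    · exact (mul_eq_zero.1 htotal).resolve_left (pow_ne_zero _ (by norm_num))
    · intro S hS hne
      rw [hsmall S (mem_ssubsets.2 ((mem_powerset.1 hS).ssubset_of_ne hne)), mul_zero]
  simpa using LinearMap.finrank_le_finrank_of_injective hW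

theorem Nat.choose_le_choose_of_le_half {n a b : ℕ} (hab : a ≤ b) (hb : b ≤ n / 2) :
    n.choose a ≤ n.choose b := by
  induction b, hab using Nat.le_induction with
  | base => exact le_rfl
  | succ b _ ih => exact (ih (by omega)).trans (Nat.choose_le_succ_of_lt_half_left (by omega))

open Finset in
/-- Sperner's bound for antichains of sets of size at most `r`, below the middle layer. -/
theorem IsAntichain.card_le_choose_of_card_le {α : Type*} [Fintype α]
    {𝒜 : Finset (Finset α)} (h𝒜 : IsAntichain (· ⊆ ·) (𝒜 : Set (Finset α))) {r : ℕ}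
    (hr : r ≤ Fintype.card α / 2) (hcard : ∀ A ∈ 𝒜, #A ≤ r) :
    #𝒜 ≤ (Fintype.card α).choose r := by
  have hpos : (0 : ℚ) < (Fintype.card α).choose r :=
    Nat.cast_pos.2 (Nat.choose_pos (hr.trans (Nat.div_le_self _ _)))
  have hsum : ∑ A ∈ 𝒜, ((Fintype.card α).choose r : ℚ)⁻¹ ≤ 1 := by
    refine le_trans (sum_le_sum fun A hA => ?_)
      (lubell_yamamoto_meshalkin_inequality_sum_inv_choose (𝕜 := ℚ) h𝒜)
    have hA_pos : (0 : ℚ) < (Fintype.card α).choose #A :=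
      Nat.cast_pos.2 (Nat.choose_pos (card_le_univ A))
    have hle := Nat.choose_le_choose_of_le_half (hcard A hA) hr
    gcongr
  rw [sum_const, nsmul_eq_mul, ← div_eq_mul_inv, div_le_one hpos] at hsum
  exact_mod_cast hsum

open Finset in
open scoped FinsetFamily in
/-- An antichain of sets of size at most `k + 1` whose members of size `k + 1` pairwise intersect
is no larger than the `k`-th layer. -/
theorem IsAntichain.card_le_choose_of_intersecting_top {α : Type*} [DecidableEq α] [Fintype α]
    {𝒜 : Finset (Finset α)} (h𝒜 : IsAntichain (· ⊆ ·) (𝒜 : Set (Finset α))) {k : ℕ}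
    (hk : k ≤ Fintype.card α / 2) (hcard : ∀ A ∈ 𝒜, #A ≤ k + 1)
    (hint : ∀ A ∈ 𝒜, #A = k + 1 → ∀ B ∈ 𝒜, #B = k + 1 → (A ∩ B).Nonempty) :
    #𝒜 ≤ (Fintype.card α).choose k := by
  set ℱ := 𝒜.filter fun A => #A = k + 1 with hℱ_def
  have hℱ : (ℱ : Set (Finset α)).Sized (k + 1) := fun A hA => (mem_filter.1 hA).2
  have hshadow : #ℱ ≤ #(∂ ℱ) := card_le_card_shadow_of_intersecting_s7 hℱ fun A hA B hB =>
    hint A (mem_filter.1 hA).1 (mem_filter.1 hA).2 B (mem_filter.1 hB).1 (mem_filter.1 hB).2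
  have hlow : ∀ A ∈ 𝒜 \ ℱ, A ∈ 𝒜 ∧ #A ≤ k := by
    intro A hA
    rw [mem_sdiff, hℱ_def, mem_filter] at hA
    have hne : #A ≠ k + 1 := fun h => hA.2 ⟨hA.1, h⟩
    have := hcard A hA.1
    exact ⟨hA.1, by omega⟩
  have hnot : ∀ A ∈ 𝒜 \ ℱ, ∀ S ∈ ∂ ℱ, ¬ A ⊆ S := by
    intro A hA S hS hAS
    obtain ⟨B, hB, hSB, hBcard⟩ := mem_shadow_iff_exists_mem_card_add_one.1 hS
    have hAB : A = B := h𝒜.eq (hlow A hA).1 (mem_filter.1 hB).1 (hAS.trans hSB)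
    exact (mem_sdiff.1 hA).2 (hAB ▸ hB)
  have hshadow_card : ∀ S ∈ ∂ ℱ, #S = k := fun S hS => hℱ.shadow hS
  have hdisj : Disjoint (𝒜 \ ℱ) (∂ ℱ) :=
    disjoint_left.2 fun A hA hA' => hnot A hA A hA' Subset.rfl
  have hanti : IsAntichain (· ⊆ ·) ((𝒜 \ ℱ ∪ ∂ ℱ : Finset (Finset α)) : Set (Finset α)) := by
    intro A hA B hB hne hAB
    rcases mem_union.1 (mem_coe.1 hA) with hA | hA <;>
      rcases mem_union.1 (mem_coe.1 hB) with hB | hB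
    · exact hne (h𝒜.eq (hlow A hA).1 (hlow B hB).1 hAB)
    · exact hnot A hA B hB hAB
    · refine hne (eq_of_subset_of_card_le hAB ?_)
      rw [hshadow_card A hA]
      exact (hlow B hB).2
    · refine hne (eq_of_subset_of_card_le hAB ?_)
      rw [hshadow_card A hA, hshadow_card B hB]
  have hbound := hanti.card_le_choose_of_card_le hk fun A hA =>
    (mem_union.1 hA).elim (fun h => (hlow A h).2) fun h => (hshadow_card A h).le
  rw [card_union_of_disjoint hdisj] at hbound
  have hsplit : #(𝒜 \ ℱ) + #ℱ = #𝒜 := card_sdiff_add_card_eq_card (filter_subset _ _)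
  omega

theorem choose_middle_lt_choose {k : ℕ} (hk : 2 ≤ k) :
    (2 * k + 2).choose (k + 1) < (2 * k + 3).choose k := by
  have h₁ := Nat.add_one_mul_choose_eq (2 * k + 2) (k + 1)
  have h₂ := Nat.choose_succ_right_eq (2 * k + 3) k
  have h₃ : (2 * k + 3).choose (k + 2) = (2 * k + 3).choose (k + 1) :=
    Nat.choose_symm_of_eq_add (by omega)
  have h₄ : 2 * k + 3 - k = k + 3 := by omega
  have hpos : 0 < (2 * k + 2).choose (k + 1) := Nat.choose_pos (by omega)
  rw [h₃] at h₁
  rw [h₄] at h₂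
  set C := (2 * k + 2).choose (k + 1)
  set D := (2 * k + 3).choose k
  set E := (2 * k + 3).choose (k + 1)
  have hmul : (2 * k + 3) * (k + 1) * C = (k + 2) * (k + 3) * D := by
    linear_combination (k + 1) * h₁ + (k + 2) * h₂
  by_contra! hle
  have := Nat.mul_le_mul_left ((k + 2) * (k + 3)) hle
  nlinarith

theorem mem_coin {n : ℕ} {Q : Type*} [DecidableEq Q] {x y : Fin n → Q} {p : Fin n} :
    p ∈ coin x y ↔ x p = y p := by
  simp [coin]

/-- In a wide-sense 2-frameproof code, a third codeword differs from `c a` at some position where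
`c a` and `c b` agree. -/
theorem IsWFP2.not_coin_subset {n m : ℕ} {Q : Type*} [DecidableEq Q] {c : Fin m → (Fin n → Q)}
    (hinj : Function.Injective c) (hwfp : IsWFP2 (Finset.image c Finset.univ))
    {a b s : Fin m} (hsa : s ≠ a) (hsb : s ≠ b) :
    ¬ coin (c a) (c b) ⊆ coin (c a) (c s) := by
  intro hsub
  have heq := hwfp {c a, c b} (by intro x hx; aesop) ⟨c a, by simp⟩ Finset.card_le_two
  have hmem : c s ∈ (({c a, c b} : Finset (Fin n → Q)) : Set (Fin n → Q)) := by
    rw [← heq]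
    refine ⟨fun p hp x hx => ?_, by simp⟩
    have hab : c a p = c b p := hp _ (by simp) _ (by simp)
    have has : c a p = c s p := mem_coin.1 (hsub (mem_coin.2 hab))
    rw [hp x hx (c a) (by simp), has]
  simp only [Finset.coe_insert, Finset.coe_singleton, Set.mem_insert_iff,
    Set.mem_singleton_iff, hinj.eq_iff] at hmem
  tauto

/-- If two codewords of a wide-sense 2-frameproof code agree in exactly one position, the code has
at most two words more than the largest antichain on the other positions. -/
theorem IsWFP2.card_le_of_coin_eq_singleton {n m : ℕ} {Q : Type*} [DecidableEq Q]
    {c : Fin m → (Fin n → Q)} (hinj : Function.Injective c)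
    (hwfp : IsWFP2 (Finset.image c Finset.univ)) {j l : Fin m} {p : Fin n}
    (hp : coin (c j) (c l) = {p}) : m ≤ (n - 1).choose ((n - 1) / 2) + 2 := by
  classical
  set I := (Finset.univ : Finset (Fin m)) \ {j, l}
  let f : Fin m → Finset {x : Fin n // x ≠ p} := fun s => (coin (c j) (c s)).subtype (· ≠ p)
  have hI : ∀ s ∈ I, s ≠ j ∧ s ≠ l := by
    intro s hs
    simpa [I] using hs
  have hf : ∀ s ∈ I, ∀ t ∈ I, f s ⊆ f t → s = t := by
    intro s hs t ht hst
    by_contra hne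
    refine hwfp.not_coin_subset hinj (a := j) (hI t ht).1 (Ne.symm hne) fun x hx => ?_
    have hxp : x ≠ p := by
      rintro rfl
      apply hwfp.not_coin_subset hinj (hI s hs).1 (hI s hs).2
      rw [hp]
      simpa using hx
    simpa [f] using hst (show (⟨x, hxp⟩ : {x : Fin n // x ≠ p}) ∈ f s by simpa [f] using hx)
  have hanti : IsAntichain (· ⊆ ·) ((I.image f : Finset _) : Set (Finset {x // x ≠ p})) := by
    intro A hA B hB hne hAB
    obtain ⟨s, hs, rfl⟩ := Finset.mem_image.1 (Finset.mem_coe.1 hA)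
    obtain ⟨t, ht, rfl⟩ := Finset.mem_image.1 (Finset.mem_coe.1 hB)
    exact hne (congrArg f (hf s hs t ht hAB))
  have hsperner := hanti.sperner
  rw [Finset.card_image_of_injOn fun s hs t ht hst => hf s hs t ht (le_of_eq hst)] at hsperner
  have hcard : Fintype.card {x : Fin n // x ≠ p} = n - 1 := by
    simp
  rw [hcard] at hsperner
  have hIcard := Finset.le_card_sdiff ({j, l} : Finset (Fin m)) Finset.univ
  have htwo : ({j, l} : Finset (Fin m)).card ≤ 2 := Finset.card_le_two
  rw [Finset.card_univ, Fintype.card_fin] at hIcard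
  change m - _ ≤ I.card at hIcard
  omega

/-- For odd `n ≥ 7`, if some codeword `c i` of an `(n,m,q)` wide-sense 2-frameproof
code satisfies `|I(i,j)| ≤ (n-1)/2` for all `j ≠ i`, then `m ≤ C(n, (n+3)/2) + 1`. -/
theorem wfp2_small_coincidence_bound {n m q : ℕ} {Q : Type*} [Fintype Q] [DecidableEq Q]
    (hq : Fintype.card Q = q) (hq2 : 2 ≤ q)
    (hodd : Odd n) (hn7 : 7 ≤ n)
    (c : Fin m → (Fin n → Q)) (hinj : Function.Injective c)
    (hwfp : IsWFP2 (Finset.image c Finset.univ))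
    (i : Fin m) (h : ∀ j : Fin m, j ≠ i → (coin (c i) (c j)).card ≤ (n - 1) / 2) :
    m ≤ n.choose ((n + 3) / 2) + 1 := by
  classical
  obtain ⟨r, rfl⟩ := hodd
  obtain ⟨k, rfl⟩ : ∃ k, r = k + 1 := ⟨r - 1, by omega⟩
  have hhalf : (2 * (k + 1) + 1 - 1) / 2 = k + 1 := by omega
  have hchoose : (2 * (k + 1) + 1).choose ((2 * (k + 1) + 1 + 3) / 2)
      = (2 * (k + 1) + 1).choose k := Nat.choose_symm_of_eq_add (by omega)
  rw [hhalf] at h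
  rw [hchoose]
  by_cases hdisj : ∃ j l : Fin m, j ≠ i ∧ l ≠ i ∧ j ≠ l ∧ (coin (c i) (c j)).card = k + 1 ∧
      (coin (c i) (c l)).card = k + 1 ∧ Disjoint (coin (c i) (c j)) (coin (c i) (c l))
  · obtain ⟨j, l, hj, hl, hjl, hjcard, hlcard, hd⟩ := hdisj
    obtain ⟨p, hpj, hpi⟩ :=
      Finset.not_subset.1 (hwfp.not_coin_subset hinj (a := j) (b := l) hj.symm hl.symm)
    have hsub : coin (c j) (c l) ⊆ (coin (c i) (c j) ∪ coin (c i) (c l))ᶜ := by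
      intro x hx
      rw [Finset.mem_compl, Finset.mem_union]
      rw [Finset.disjoint_left] at hd
      have hd' := @hd x
      simp only [mem_coin] at hx hd' ⊢
      rw [hx] at hd' ⊢
      tauto
    have hcompl : (coin (c i) (c j) ∪ coin (c i) (c l))ᶜ.card = 1 := by
      rw [Finset.card_compl, Finset.card_union_of_disjoint hd, Fintype.card_fin, hjcard, hlcard]
      omega
    have hp : coin (c j) (c l) = {p} := by
      refine Finset.eq_singleton_iff_unique_mem.2 ⟨hpj, fun x hx => ?_⟩
      exact Finset.card_le_one.1 hcompl.le x (hsub hx) p (hsub hpj)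
    have hm := hwfp.card_le_of_coin_eq_singleton hinj hp
    have hlt := choose_middle_lt_choose (k := k) (by omega)
    rw [hhalf, show 2 * (k + 1) + 1 - 1 = 2 * k + 2 by omega] at hm
    rw [show 2 * (k + 1) + 1 = 2 * k + 3 by omega]
    omega
  · push Not at hdisj
    set 𝒜 := (Finset.univ.erase i).image fun j => coin (c i) (c j) with h𝒜
    have hsubset : ∀ s, s ≠ i → ∀ t, t ≠ i → coin (c i) (c s) ⊆ coin (c i) (c t) → s = t := by
      intro s hs t ht hst
      by_contra hne
      exact hwfp.not_coin_subset hinj ht (Ne.symm hne) hst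
    have hmem : ∀ A ∈ 𝒜, ∃ s, s ≠ i ∧ coin (c i) (c s) = A := by
      intro A hA
      simpa [h𝒜] using hA
    have hcard𝒜 : 𝒜.card = m - 1 := by
      rw [h𝒜, Finset.card_image_of_injOn fun s hs t ht hst =>
        hsubset s (Finset.ne_of_mem_erase hs) t (Finset.ne_of_mem_erase ht) (le_of_eq hst)]
      simp
    have hanti : IsAntichain (· ⊆ ·) (𝒜 : Set (Finset (Fin (2 * (k + 1) + 1)))) := by
      intro A hA B hB hne hAB
      obtain ⟨s, hs, rfl⟩ := hmem A hA
      obtain ⟨t, ht, rfl⟩ := hmem B hB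
      exact hne (by rw [hsubset s hs t ht hAB])
    have hbound := hanti.card_le_choose_of_intersecting_top (k := k)
      (by rw [Fintype.card_fin]; omega)
      (fun A hA => by obtain ⟨s, hs, rfl⟩ := hmem A hA; exact h s hs)
      (fun A hA hAcard B hB hBcard => by
        obtain ⟨s, hs, rfl⟩ := hmem A hA
        obtain ⟨t, ht, rfl⟩ := hmem B hB
        rw [← Finset.not_disjoint_iff_nonempty_inter]
        by_cases hst : s = t
        · subst hst
          rw [disjoint_self, Finset.bot_eq_empty, ← Finset.card_eq_zero]
          omega
        · exact hdisj s t hs ht hst hAcard hBcard)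
    rw [hcard𝒜, Fintype.card_fin] at hbound
    omega
end

section
/- Let n be even and let F be a nonempty Sperner family of subsets of [n]; let l and u be the minimum and maximum sizes of members of F. If l < n/2 and u > n/2, then |F| ≤ (n choose n/2) − (u−l)·(n/2) − ⌊(u−l−1)²/4⌋. -/
open Finset FinsetFamily

/-- A family of `k`-subsets of `U` with `2 * k + 1 ≤ #U` is no larger than any family
containing all its one-element extensions within `U`. -/
theorem card_le_card_of_insert_mem {α : Type*} [DecidableEq α] {k : ℕ} {U : Finset α}
    {S T : Finset (Finset α)} (hS : S ⊆ U.powersetCard k)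
    (hT : ∀ A ∈ S, ∀ x ∈ U \ A, insert x A ∈ T) (hk : 2 * k + 1 ≤ #U) : #S ≤ #T := by
  have h := card_mul_le_card_mul (s := S) (t := T) (m := k + 1) (n := k + 1)
    (fun A B => A ⊆ B ∧ #B = k + 1) ?_ ?_
  · exact Nat.le_of_mul_le_mul_right h k.succ_pos
  · intro A hA
    obtain ⟨hAU, hAk⟩ := mem_powersetCard.1 (hS hA)
    calc k + 1 ≤ #(U \ A) := by rw [card_sdiff_of_subset hAU]; omega
      _ = #((U \ A).image fun x => insert x A) := by
        refine (card_image_of_injOn fun x hx y hy hxy => ?_).symm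
        have hx' := (mem_sdiff.1 hx).2
        have : x ∈ insert y A := by rw [← show insert x A = insert y A from hxy]; simp
        exact (mem_insert.1 this).resolve_right hx'
      _ ≤ _ := by
        refine card_le_card fun B hB => ?_
        obtain ⟨x, hx, rfl⟩ := mem_image.1 hB
        refine (mem_bipartiteAbove _).2 ⟨hT A hA x hx, subset_insert _ _, ?_⟩
        rw [card_insert_of_notMem (mem_sdiff.1 hx).2, hAk]
  · intro B _
    by_cases hB : #B = k + 1
    · calc _ ≤ #(B.powersetCard k) := by
            refine card_le_card fun A hA => ?_
            obtain ⟨hA, hAB, -⟩ := (mem_bipartiteBelow _).1 hA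
            exact mem_powersetCard.2 ⟨hAB, (mem_powersetCard.1 (hS hA)).2⟩
        _ = k + 1 := by rw [card_powersetCard, hB, Nat.choose_succ_self_right]
    · rw [bipartiteBelow, filter_false_of_mem (fun A _ h => hB h.2)]
      simp

/-- A nonempty family of `k`-subsets of `U` with `2 * k + 2 ≤ #U` grows by at least
`#U - k - 1` when passing to its one-element extensions within `U`. -/
theorem card_add_le_card_of_insert_mem {α : Type*} [DecidableEq α] {k : ℕ} {U : Finset α}
    {S T : Finset (Finset α)} (hS : S ⊆ U.powersetCard k)
    (hT : ∀ A ∈ S, ∀ x ∈ U \ A, insert x A ∈ T) (hk : 2 * k + 2 ≤ #U) (hne : S.Nonempty) :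
    #S + (#U - k - 1) ≤ #T := by
  induction k generalizing U S T with
  | zero =>
    rw [powersetCard_zero] at hS
    obtain rfl : S = {∅} := (subset_singleton_iff.1 hS).resolve_left hne.ne_empty
    have : #U ≤ #T := by
      rw [← card_image_of_injective U (singleton_injective (α := α))]
      refine card_le_card fun B hB => ?_
      obtain ⟨x, hx, rfl⟩ := mem_image.1 hB
      simpa using hT ∅ (by simp) x (by simpa using hx)
    rw [card_singleton]
    omega
  | succ k ih =>
    obtain ⟨A, hA⟩ := hne
    have hsize : ∀ {B}, B ∈ S → B ⊆ U ∧ #B = k + 1 := fun hB => mem_powersetCard.1 (hS hB)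
    obtain ⟨x, hx⟩ : A.Nonempty := card_pos.1 (by rw [(hsize hA).2]; omega)
    have hxU : x ∈ U := (hsize hA).1 hx
    have hU : #(U.erase x) = #U - 1 := card_erase_of_mem hxU
    have hmem := ih (U := U.erase x) (S := S.memberSubfamily x) (T := T.memberSubfamily x)
      (fun B hB => by
        obtain ⟨hB, hxB⟩ := mem_memberSubfamily.1 hB
        obtain ⟨hBU, hBk⟩ := hsize hB
        rw [card_insert_of_notMem hxB] at hBk
        exact mem_powersetCard.2
          ⟨subset_erase.2 ⟨(subset_insert _ _).trans hBU, hxB⟩, by omega⟩)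
      (fun B hB y hy => by
        obtain ⟨hB, hxB⟩ := mem_memberSubfamily.1 hB
        simp only [mem_sdiff, mem_erase] at hy
        refine mem_memberSubfamily.2 ⟨?_, by simp [hxB, hy.1.1.symm]⟩
        rw [insert_comm]
        exact hT _ hB y (by simp [hy.1.1, hy.1.2, hy.2]))
      (by omega)
      ⟨A.erase x, mem_memberSubfamily.2 ⟨by rwa [insert_erase hx], notMem_erase _ _⟩⟩
    have hnon := card_le_card_of_insert_mem (k := k + 1) (U := U.erase x)
      (S := S.nonMemberSubfamily x) (T := T.nonMemberSubfamily x)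
      (fun B hB => by
        obtain ⟨hB, hxB⟩ := mem_nonMemberSubfamily.1 hB
        exact mem_powersetCard.2 ⟨subset_erase.2 ⟨(hsize hB).1, hxB⟩, (hsize hB).2⟩)
      (fun B hB y hy => by
        obtain ⟨hB, hxB⟩ := mem_nonMemberSubfamily.1 hB
        simp only [mem_sdiff, mem_erase] at hy
        exact mem_nonMemberSubfamily.2
          ⟨hT B hB y (by simp [hy.1.2, hy.2]), by simp [hxB, hy.1.1.symm]⟩)
      (by omega)
    have hcS := card_memberSubfamily_add_card_nonMemberSubfamily x S
    have hcT := card_memberSubfamily_add_card_nonMemberSubfamily x T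
    omega

/-- The `m`-element sets that contain some member of `L`. -/
def liftToLevel {α : Type*} [DecidableEq α] [Fintype α] (m : ℕ) (L : Finset (Finset α)) :
    Finset (Finset α) :=
  {B ∈ (univ : Finset α).powersetCard m | ∃ A ∈ L, A ⊆ B}

/-- Lifting an antichain of sets of size at most `m`, the smallest of which has size `m - a`,
to the middle level `m` of the cube of dimension `2 * m` adds at least
`a * m + a * (a - 1) / 2` sets. -/
theorem two_mul_card_add_le_card_lift {α : Type*} [DecidableEq α] [Fintype α] {m a : ℕ}
    (hα : Fintype.card α = 2 * m) (ham : a ≤ m) {L : Finset (Finset α)}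
    (hL : IsAntichain (· ⊆ ·) (L : Set (Finset α)))
    (hmin : ∀ A ∈ L, m - a ≤ #A) (hmax : ∀ A ∈ L, #A ≤ m) (hatt : ∃ A ∈ L, #A = m - a) :
    2 * #L + 2 * a * m + a * a ≤
      2 * #(liftToLevel m L) + a := by
  induction a generalizing L with
  | zero =>
    have : #L ≤ #(liftToLevel m L) := by
      refine card_le_card fun A hA => mem_filter.2 ⟨?_, A, hA, Subset.rfl⟩
      have := hmin A hA
      have := hmax A hA
      exact mem_powersetCard.2 ⟨subset_univ _, by omega⟩
    omega
  | succ a ih =>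
    set k := m - (a + 1) with hk
    set S := {A ∈ L | #A = k}
    set R := {A ∈ L | ¬ #A = k}
    have hSR : #S + #R = #L := card_filter_add_card_filter_not _
    have hSmem : ∀ {A}, A ∈ S → A ∈ L ∧ #A = k := fun h => mem_filter.1 h
    have hRmem : ∀ {A}, A ∈ R → A ∈ L ∧ ¬ #A = k := fun h => mem_filter.1 h
    have hup : ∀ {B}, B ∈ ∂⁺ S → #B = k + 1 ∧ ∃ A ∈ S, A ⊆ B := by
      intro B hB
      obtain ⟨A, hA, x, hx, rfl⟩ := mem_upShadow_iff.1 hB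
      exact ⟨by rw [card_insert_of_notMem hx, (hSmem hA).2], A, hA, subset_insert _ _⟩
    have hRcard : ∀ {A}, A ∈ R → k + 1 ≤ #A := fun {A} hA => by
      have := hmin A (hRmem hA).1
      have := (hRmem hA).2
      omega
    have hnot : ∀ {B C}, B ∈ ∂⁺ S → C ∈ R → ¬ B ⊆ C := by
      intro B C hB hC hBC
      obtain ⟨-, A, hA, hAB⟩ := hup hB
      have := hL.eq (hSmem hA).1 (hRmem hC).1 (hAB.trans hBC)
      exact (hRmem hC).2 (this ▸ (hSmem hA).2)
    have hgrow : #S + (Fintype.card α - k - 1) ≤ #(∂⁺ S) := by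
      refine card_add_le_card_of_insert_mem (U := univ)
        (fun A hA => mem_powersetCard.2 ⟨subset_univ _, (hSmem hA).2⟩)
        (fun A hA x hx => insert_mem_upShadow hA (mem_sdiff.1 hx).2)
        (by rw [card_univ]; omega) ?_
      obtain ⟨A, hA, hAk⟩ := hatt
      exact ⟨A, mem_filter.2 ⟨hA, hAk⟩⟩
    have hdisj : Disjoint (∂⁺ S) R :=
      disjoint_left.2 fun B hB hB' => hnot hB hB' Subset.rfl
    have hcard := card_union_of_disjoint hdisj
    have key := ih (L := ∂⁺ S ∪ R) (by omega) ?_ ?_ ?_ ?_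
    · have hsub : #(liftToLevel m (∂⁺ S ∪ R)) ≤
          #(liftToLevel m L) := by
        refine card_le_card fun B hB => ?_
        obtain ⟨hB, A, hA, hAB⟩ := mem_filter.1 hB
        refine mem_filter.2 ⟨hB, ?_⟩
        rcases mem_union.1 hA with hA | hA
        · obtain ⟨-, C, hC, hCA⟩ := hup hA
          exact ⟨C, (hSmem hC).1, hCA.trans hAB⟩
        · exact ⟨A, (hRmem hA).1, hAB⟩
      have hgain : #L + (m + a) ≤ #(∂⁺ S ∪ R) := by omega
      have hexp : 2 * (a + 1) * m + (a + 1) * (a + 1) =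
          2 * a * m + a * a + 2 * m + 2 * a + 1 := by ring
      omega
    · intro B hB C hC hne hBC
      rcases mem_union.1 hB with hB | hB <;> rcases mem_union.1 hC with hC | hC
      · exact hne (eq_of_subset_of_card_le hBC (by rw [(hup hB).1, (hup hC).1]))
      · exact hnot hB hC hBC
      · exact hne (eq_of_subset_of_card_le hBC (by rw [(hup hC).1]; exact hRcard hB))
      · exact hne (hL.eq (hRmem hB).1 (hRmem hC).1 hBC)
    · intro A hA
      rcases mem_union.1 hA with hA | hA
      · have := (hup hA).1
        omega
      · have := hRcard hA
        omega
    · intro A hA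
      rcases mem_union.1 hA with hA | hA
      · have := (hup hA).1
        omega
      · exact hmax A (hRmem hA).1
    · obtain ⟨B, hB⟩ : (∂⁺ S).Nonempty := card_pos.1 (by omega)
      exact ⟨B, mem_union_left _ hB, by rw [(hup hB).1]; omega⟩

/-- For even `n`, a nonempty Sperner family with minimum member size `l < n/2` and
maximum member size `u > n/2` has `|F| ≤ C(n, n/2) - (u-l)·(n/2) - ⌊(u-l-1)²/4⌋`. -/
theorem sperner_bound_even_spread {n l u : ℕ} (hn : Even n)
    (F : Finset (Finset (Fin n))) (hne : F.Nonempty) (hS : IsSperner F)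
    (hlmin : ∀ A ∈ F, l ≤ A.card) (hlatt : ∃ A ∈ F, A.card = l)
    (humax : ∀ A ∈ F, A.card ≤ u) (huatt : ∃ A ∈ F, A.card = u)
    (hl : l < n / 2) (hu : n / 2 < u) :
    F.card + (u - l) * (n / 2) + (u - l - 1) ^ 2 / 4 ≤ n.choose (n / 2) := by
  obtain ⟨m, hm⟩ := hn
  have hnm : n / 2 = m := by omega
  rw [hnm] at hl hu ⊢
  have hα : Fintype.card (Fin n) = 2 * m := by rw [Fintype.card_fin]; omega
  have hun : u ≤ n := by
    obtain ⟨A, -, rfl⟩ := huatt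
    simpa using card_le_univ A
  have hcompl : ∀ A : Finset (Fin n), #Aᶜ = 2 * m - #A := fun A => by rw [card_compl, hα]
  have hcF : #{A ∈ F | #A ≤ m} + #{A ∈ F | ¬ #A ≤ m} = #F :=
    card_filter_add_card_filter_not _
  set H : Finset (Finset (Fin n)) := {A ∈ F | ¬ #A ≤ m}.image compl
  have hcH : #H = #{A ∈ F | ¬ #A ≤ m} := card_image_of_injective _ compl_injective
  have hHmem : ∀ {A}, A ∈ H → ∃ B ∈ F, m < #B ∧ Bᶜ = A := by
    intro A hA
    obtain ⟨B, hB, rfl⟩ := mem_image.1 hA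
    exact ⟨B, (mem_filter.1 hB).1, not_le.1 (mem_filter.1 hB).2, rfl⟩
  have low := two_mul_card_add_le_card_lift (a := m - l) hα (by omega)
    (L := {A ∈ F | #A ≤ m})
    (fun A hA B hB hAB h => hAB (hS A (mem_filter.1 hA).1 B (mem_filter.1 hB).1 h))
    (fun A hA => by
      have := hlmin A (mem_filter.1 hA).1
      omega)
    (fun A hA => (mem_filter.1 hA).2)
    (by
      obtain ⟨A, hA, hAl⟩ := hlatt
      exact ⟨A, mem_filter.2 ⟨hA, by omega⟩, by omega⟩)
  have high := two_mul_card_add_le_card_lift (a := u - m) hα (by omega) (L := H)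
    (fun A hA B hB hAB h => by
      obtain ⟨C, hC, -, rfl⟩ := hHmem hA
      obtain ⟨D, hD, -, rfl⟩ := hHmem hB
      exact hAB (congrArg compl (hS D hD C hC (compl_subset_compl.1 h)).symm))
    (fun A hA => by
      obtain ⟨B, hB, -, rfl⟩ := hHmem hA
      have := humax B hB
      rw [hcompl]
      omega)
    (fun A hA => by
      obtain ⟨B, hB, hBm, rfl⟩ := hHmem hA
      rw [hcompl]
      omega)
    (by
      obtain ⟨A, hA, hAu⟩ := huatt
      exact ⟨Aᶜ, mem_image_of_mem _ (mem_filter.2 ⟨hA, by omega⟩), by rw [hcompl]; omega⟩)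
  set T₁ := liftToLevel m {A ∈ F | #A ≤ m}
  set T₂ := liftToLevel m H
  have hT : #T₁ + #T₂ ≤ n.choose m := by
    rw [← card_image_of_injective T₂ compl_injective, ← card_union_of_disjoint]
    · refine (card_le_card (union_subset (filter_subset _ _) fun B hB => ?_)).trans_eq
        (by rw [card_powersetCard, card_univ, Fintype.card_fin])
      obtain ⟨C, hC, rfl⟩ := mem_image.1 hB
      have := (mem_powersetCard.1 (mem_filter.1 hC).1).2
      exact mem_powersetCard.2 ⟨subset_univ _, by rw [hcompl]; omega⟩
    · refine disjoint_left.2 fun B hB hB' => ?_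
      obtain ⟨-, A, hA, hAB⟩ := mem_filter.1 hB
      obtain ⟨C, hC, rfl⟩ := mem_image.1 hB'
      obtain ⟨-, D, hD, hDC⟩ := mem_filter.1 hC
      obtain ⟨D, hDF, hDm, rfl⟩ := hHmem hD
      obtain ⟨hAF, hAm⟩ := mem_filter.1 hA
      have hAD : A ⊆ D := hAB.trans (by simpa using compl_subset_compl.2 hDC)
      have := hS A hAF D hDF hAD
      subst this
      omega
  obtain ⟨a, rfl⟩ : ∃ a, m = l + a := ⟨m - l, by omega⟩
  obtain ⟨b, rfl⟩ : ∃ b, u = l + a + b := ⟨u - (l + a), by omega⟩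
  obtain ⟨s, hs⟩ : ∃ s, a + b = s + 1 := ⟨a + b - 1, by omega⟩
  have e₁ : l + a - l = a := by omega
  have e₂ : l + a + b - (l + a) = b := by omega
  have e₃ : l + a + b - l = s + 1 := by omega
  rw [e₁] at low
  rw [e₂] at high
  rw [e₃, Nat.add_sub_cancel]
  have hq := Nat.div_mul_le_self (s ^ 2) 4
  set q := s ^ 2 / 4
  have hsq : (s + 1) ^ 2 ≤ 2 * (a * a + b * b) := by
    rw [← hs]
    zify
    nlinarith [sq_nonneg ((a : ℤ) - b)]
  have hmul : 2 * a * (l + a) + 2 * b * (l + a) = 2 * ((s + 1) * (l + a)) := by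
    rw [← hs]; ring
  have hexp : (s + 1) ^ 2 = s ^ 2 + 2 * s + 1 := by ring
  omega
end

section
/- Let F be a nonempty Sperner family of subsets of [n]; let l and u be the minimum and maximum sizes of members of F. If l < ⌊n/2⌋ and u = ⌈n/2⌉, then |F| ≤ (n choose ⌊n/2⌋) − (⌊n/2⌋ − l)·⌈n/2⌉ − (⌊n/2⌋ − l)(⌊n/2⌋ − l − 1)/2. -/
open Finset
open scoped FinsetFamily

namespace IsSperner

variable {n : ℕ} {F : Finset (Finset (Fin n))}

/-- A nonempty family `G` of `k`-sets with `2 * (k + 1) ≤ n` has an upper shadow larger than `G`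
by at least `n - k - 1`. -/
theorem card_add_le_card_upShadow {k : ℕ} (hk : 2 * (k + 1) ≤ n) (G : Finset (Finset (Fin n)))
    (hG : ∀ A ∈ G, A.card = k) (hne : G.Nonempty) :
    G.card + (n - k - 1) ≤ (∂⁺ G).card := by
  classical
  obtain ⟨A, hA⟩ := hne
  have hup (B : Finset (Fin n)) : (Bᶜ.image fun a => insert a B).card = n - B.card := by
    rw [card_image_of_injOn (insert_inj_on' _), card_compl, Fintype.card_fin]
  set U := Aᶜ.image fun a => insert a A with hU
  have hUsub : U ⊆ ∂⁺ G := by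
    intro T hT
    obtain ⟨a, ha, rfl⟩ := mem_image.1 hT
    exact insert_mem_upShadow hA (mem_compl.1 ha)
  have hUcard : U.card = n - k := by rw [hU, hup, hG A hA]
  have hcount : (G.erase A).card * (n - k - 1) ≤ (∂⁺ G \ U).card * (k + 1) := by
    refine card_mul_le_card_mul (· ⊆ ·) (fun S hS => ?_) (fun T hT => ?_)
    · obtain ⟨hSA, hSG⟩ := mem_erase.1 hS
      have hsub : (Sᶜ.image fun a => insert a S).erase (S ∪ A) ⊆
          (∂⁺ G \ U).bipartiteAbove (· ⊆ ·) S := by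
        intro T hT
        obtain ⟨hTne, hT⟩ := mem_erase.1 hT
        obtain ⟨a, ha, rfl⟩ := mem_image.1 hT
        have haS := mem_compl.1 ha
        refine (mem_bipartiteAbove _).2 ⟨mem_sdiff.2 ⟨insert_mem_upShadow hSG haS, fun hmem => ?_⟩,
          subset_insert _ _⟩
        obtain ⟨b, -, hb⟩ := mem_image.1 hmem
        have hAsub : A ⊆ insert a S := hb ▸ subset_insert b A
        refine hTne (eq_of_subset_of_card_le (union_subset (subset_insert _ _) hAsub) ?_).symm
        rw [card_insert_of_notMem haS]
        refine card_lt_card (ssubset_of_subset_of_ne subset_union_left fun h => hSA ?_)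
        exact (eq_of_subset_of_card_le (union_eq_left.1 h.symm)
          (by rw [hG S hSG, hG A hA])).symm
      have h := card_le_card hsub
      have h' := pred_card_le_card_erase (s := Sᶜ.image fun a => insert a S) (a := S ∪ A)
      rw [hup, hG S hSG] at h'
      exact h'.trans h
    · have hTG := (mem_sdiff.1 hT).1
      have hTcard : T.card = k + 1 := by
        obtain ⟨B, hB, a, ha, rfl⟩ := mem_upShadow_iff.1 hTG
        rw [card_insert_of_notMem ha, hG B hB]
      calc _ ≤ (T.powersetCard k).card := card_le_card fun S hS => by
            obtain ⟨hS, hST⟩ := (mem_bipartiteBelow _).1 hS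
            exact mem_powersetCard.2 ⟨hST, hG S (mem_of_mem_erase hS)⟩
        _ = k + 1 := by rw [card_powersetCard, hTcard, Nat.choose_succ_self_right]
  have hle : (G.erase A).card ≤ (∂⁺ G \ U).card := by
    refine Nat.le_of_mul_le_mul_right (c := k + 1) ?_ k.succ_pos
    exact (Nat.mul_le_mul_left _ (by omega)).trans hcount
  have hcard := card_sdiff_add_card_eq_card hUsub
  have hpos : 0 < G.card := card_pos.2 ⟨A, hA⟩
  rw [card_erase_of_mem hA] at hle
  omega

/-- Replacing the members of minimum size by their upper shadow preserves the Sperner property. -/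
theorem exists_card_add_le_of_min {l : ℕ} (hS : IsSperner F) (hl : 2 * (l + 1) ≤ n)
    (hmin : ∀ A ∈ F, l ≤ A.card) (hatt : ∃ A ∈ F, A.card = l) :
    ∃ F' : Finset (Finset (Fin n)), IsSperner F' ∧ (∀ A ∈ F', l + 1 ≤ A.card) ∧
      (∃ A ∈ F', A.card = l + 1) ∧ (∀ m, l + 1 ≤ m → (∀ A ∈ F, A.card ≤ m) →
        ∀ A ∈ F', A.card ≤ m) ∧ F.card + (n - l - 1) ≤ F'.card := by
  classical
  set G := F.filter (·.card = l)
  set R := F.filter (¬ ·.card = l)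
  have hG : ∀ A ∈ G, A.card = l := fun A hA => (mem_filter.1 hA).2
  have hGne : G.Nonempty := by
    obtain ⟨A, hA, hAl⟩ := hatt
    exact ⟨A, mem_filter.2 ⟨hA, hAl⟩⟩
  have hR : ∀ A ∈ R, A ∈ F ∧ l + 1 ≤ A.card := fun A hA => by
    obtain ⟨h, h'⟩ := mem_filter.1 hA
    exact ⟨h, by have := hmin A h; omega⟩
  have hU : ∀ T ∈ ∂⁺ G, T.card = l + 1 ∧ ∃ B ∈ F, B.card = l ∧ B ⊆ T := fun T hT => by
    obtain ⟨B, hB, a, ha, rfl⟩ := mem_upShadow_iff.1 hT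
    exact ⟨by rw [card_insert_of_notMem ha, hG B hB], B, (mem_filter.1 hB).1, hG B hB,
      subset_insert _ _⟩
  have hnot : ∀ T ∈ ∂⁺ G, ∀ S ∈ R, ¬ T ⊆ S := fun T hT S hSR hTS => by
    obtain ⟨-, B, hB, hBl, hBT⟩ := hU T hT
    obtain ⟨hSF, hSl⟩ := hR S hSR
    have := hS B hB S hSF (hBT.trans hTS)
    subst this
    omega
  have hcard := card_add_le_card_upShadow hl G hG hGne
  have hdisj : Disjoint R (∂⁺ G) :=
    disjoint_left.2 fun S hSR hSU => hnot S hSU S hSR Subset.rfl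
  refine ⟨R ∪ ∂⁺ G, ?_, ?_, ?_, ?_, ?_⟩
  · intro A hA B hB hAB
    rcases mem_union.1 hA with hA | hA <;> rcases mem_union.1 hB with hB | hB
    · exact hS A (hR A hA).1 B (hR B hB).1 hAB
    · exact eq_of_subset_of_card_le hAB ((hU B hB).1 ▸ (hR A hA).2)
    · exact (hnot A hA B hB hAB).elim
    · exact eq_of_subset_of_card_le hAB (by rw [(hU A hA).1, (hU B hB).1])
  · intro A hA
    rcases mem_union.1 hA with hA | hA
    · exact (hR A hA).2
    · exact (hU A hA).1.ge
  · have hpos : 0 < G.card := card_pos.2 hGne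
    obtain ⟨T, hT⟩ := card_pos.1 (show 0 < (∂⁺ G).card by omega)
    exact ⟨T, mem_union_right _ hT, (hU T hT).1⟩
  · intro m hm hmax A hA
    rcases mem_union.1 hA with hA | hA
    · exact hmax A (hR A hA).1
    · exact (hU A hA).1.le.trans hm
  · have : G.card + R.card = F.card := card_filter_add_card_filter_not _
    rw [card_union_of_disjoint hdisj]
    omega

/-- Replacing the members of maximum size `u` by their shadow preserves the Sperner property, and
does not decrease the size of the family when `n + 1 ≤ 2 * u`. -/
theorem exists_card_le_of_max {u : ℕ} (hS : IsSperner F) (hu : n + 1 ≤ 2 * u)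
    (hmax : ∀ A ∈ F, A.card ≤ u) :
    ∃ F' : Finset (Finset (Fin n)), IsSperner F' ∧ (∀ A ∈ F', A.card ≤ u - 1) ∧
      (∀ A ∈ F', A ∈ F ∨ A.card = u - 1) ∧ (∀ A ∈ F, A.card < u → A ∈ F') ∧
      F.card ≤ F'.card := by
  classical
  set G := F.filter (·.card = u)
  set R := F.filter (¬ ·.card = u)
  have hG : (G : Set (Finset (Fin n))).Sized u := fun A hA => (mem_filter.1 hA).2
  have hR : ∀ A ∈ R, A ∈ F ∧ A.card ≤ u - 1 := fun A hA => by
    obtain ⟨h, h'⟩ := mem_filter.1 hA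
    exact ⟨h, by have := hmax A h; omega⟩
  have hD : ∀ T ∈ ∂ G, T.card = u - 1 ∧ ∃ B ∈ F, B.card = u ∧ T ⊆ B := fun T hT => by
    obtain ⟨B, hB, a, ha, rfl⟩ := mem_shadow_iff.1 hT
    exact ⟨by rw [card_erase_of_mem ha, hG hB], B, (mem_filter.1 hB).1, hG hB, erase_subset _ _⟩
  have hnot : ∀ T ∈ ∂ G, ∀ S ∈ R, ¬ S ⊆ T := fun T hT S hSR hST => by
    obtain ⟨-, B, hB, hBu, hTB⟩ := hD T hT
    obtain ⟨hSF, hSu⟩ := hR S hSR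
    have := hS S hSF B hB (hST.trans hTB)
    subst this
    omega
  have hdisj : Disjoint R (∂ G) :=
    disjoint_left.2 fun S hSR hSD => hnot S hSD S hSR Subset.rfl
  have hcard : G.card ≤ (∂ G).card := by
    have h := local_lubell_yamamoto_meshalkin_inequality_mul hG
    rw [Fintype.card_fin] at h
    exact Nat.le_of_mul_le_mul_right (h.trans (Nat.mul_le_mul_left _ (by omega)))
      (show 0 < u by omega)
  refine ⟨R ∪ ∂ G, ?_, ?_, ?_, ?_, ?_⟩
  · intro A hA B hB hAB
    rcases mem_union.1 hA with hA | hA <;> rcases mem_union.1 hB with hB | hB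
    · exact hS A (hR A hA).1 B (hR B hB).1 hAB
    · exact (hnot B hB A hA hAB).elim
    · exact eq_of_subset_of_card_le hAB ((hD A hA).1 ▸ (hR B hB).2)
    · exact eq_of_subset_of_card_le hAB (by rw [(hD A hA).1, (hD B hB).1])
  · intro A hA
    rcases mem_union.1 hA with hA | hA
    · exact (hR A hA).2
    · exact (hD A hA).1.le
  · intro A hA
    rcases mem_union.1 hA with hA | hA
    · exact Or.inl (hR A hA).1
    · exact Or.inr (hD A hA).1
  · exact fun A hA hAu => mem_union_left _ (mem_filter.2 ⟨hA, hAu.ne⟩)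
  · have : G.card + R.card = F.card := card_filter_add_card_filter_not _
    rw [card_union_of_disjoint hdisj]
    omega

/-- The bound for Sperner families whose members have sizes between `l` and `l + d ≤ n / 2`, the
size `l` being attained. -/
theorem card_add_le_choose_s10 (d : ℕ) {l c : ℕ} (hS : IsSperner F) (hn : l + d + c = n)
    (hd : l + d ≤ c) (hmin : ∀ A ∈ F, l ≤ A.card) (hatt : ∃ A ∈ F, A.card = l)
    (hmax : ∀ A ∈ F, A.card ≤ l + d) :
    F.card + (d * c + d * (d - 1) / 2) ≤ n.choose (l + d) := by
  induction d generalizing l F with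
  | zero =>
    have hsub : F ⊆ powersetCard l univ := fun A hA =>
      mem_powersetCard.2 ⟨subset_univ _, (hmax A hA).antisymm (hmin A hA)⟩
    simpa using card_le_card hsub
  | succ d ih =>
    obtain ⟨F', hS', hmin', hatt', hmax', hcard⟩ :=
      hS.exists_card_add_le_of_min (by omega) hmin hatt
    have h := ih hS' (by omega) (by omega) hmin' hatt' (hmax' _ (by omega) (by
      intro A hA
      have := hmax A hA
      omega))
    rw [show l + (d + 1) = l + 1 + d by omega, Nat.triangle_succ, Nat.succ_mul]
    omega

end IsSperner

/-- A nonempty Sperner family with minimum member size `l < ⌊n/2⌋` and maximum member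
size `u = ⌈n/2⌉` has
`|F| ≤ C(n, ⌊n/2⌋) - (⌊n/2⌋-l)·⌈n/2⌉ - (⌊n/2⌋-l)(⌊n/2⌋-l-1)/2`. -/
theorem sperner_bound_min_small_max_middle {n l u : ℕ}
    (F : Finset (Finset (Fin n))) (hne : F.Nonempty) (hS : IsSperner F)
    (hlmin : ∀ A ∈ F, l ≤ A.card) (hlatt : ∃ A ∈ F, A.card = l)
    (humax : ∀ A ∈ F, A.card ≤ u) (huatt : ∃ A ∈ F, A.card = u)
    (hl : l < n / 2) (hu : u = (n + 1) / 2) :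
    F.card + (n / 2 - l) * ((n + 1) / 2) + (n / 2 - l) * (n / 2 - l - 1) / 2 ≤
      n.choose (n / 2) := by
  have hmid : l + (n / 2 - l) = n / 2 := by omega
  obtain ⟨F', hS', hmin', hatt', hmax', hcard⟩ : ∃ F' : Finset (Finset (Fin n)), IsSperner F' ∧
      (∀ A ∈ F', l ≤ A.card) ∧ (∃ A ∈ F', A.card = l) ∧ (∀ A ∈ F', A.card ≤ n / 2) ∧
      F.card ≤ F'.card := by
    rcases Nat.even_or_odd' n with ⟨m, hm | hm⟩
    · exact ⟨F, hS, hlmin, hlatt, fun A hA => (humax A hA).trans (by omega), le_rfl⟩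
    · obtain ⟨F', hS', hmax', hmem, hlow, hcard⟩ := hS.exists_card_le_of_max (by omega) humax
      obtain ⟨A, hA, hAl⟩ := hlatt
      refine ⟨F', hS', fun B hB => ?_, ⟨A, hlow A hA (by omega), hAl⟩,
        fun B hB => (hmax' B hB).trans (by omega), hcard⟩
      rcases hmem B hB with h | h
      · exact hlmin B h
      · omega
  have h := hS'.card_add_le_choose_s10 (n / 2 - l) (c := (n + 1) / 2) (by omega) (by omega)
    hmin' hatt' (by rwa [hmid])
  rw [hmid] at h
  omega
end

section
/- Let F be a nonempty Sperner family of subsets of [n]; let l and u be the minimum and maximum sizes of members of F. If l = ⌊n/2⌋ and u > ⌈n/2⌉, then |F| ≤ (n choose ⌊n/2⌋) − (u − ⌈n/2⌉)·⌈n/2⌉ − (u − ⌈n/2⌉)(u − ⌈n/2⌉ − 1)/2. -/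
open Finset FinsetFamily in
/-- A family of `k`-subsets of a set with fewer than `2 * k` elements is no larger than its
shadow. -/
theorem card_le_card_shadow_of_subset_s11 {α : Type*} [DecidableEq α] {A : Finset (Finset α)}
    {V : Finset α} {k : ℕ} (hA : ∀ S ∈ A, S ⊆ V ∧ #S = k) (hV : #V < 2 * k) :
    #A ≤ #(∂ A) := by
  have hmul : #A * k ≤ #(∂ A) * k := by
    refine card_mul_le_card_mul' (· ⊆ ·) (fun S hS => ?_) (fun T hT => ?_)
    · rw [← (hA S hS).2, ← card_image_of_injOn S.erase_injOn]
      refine card_le_card ?_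
      simp_rw [image_subset_iff, mem_bipartiteBelow]
      exact fun x hx => ⟨erase_mem_shadow hS hx, erase_subset _ _⟩
    · obtain ⟨S, hS, x, hx, rfl⟩ := mem_shadow_iff.1 hT
      have hcard : #(V \ S.erase x) ≤ k := by
        have hsub : S.erase x ⊆ V := (erase_subset _ _).trans (hA S hS).1
        rw [card_sdiff_of_subset hsub, card_erase_of_mem hx, (hA S hS).2]
        omega
      refine le_trans ?_ hcard
      refine le_trans (card_le_card ?_) (card_image_le (f := fun y => insert y (S.erase x)))
      intro R hR
      rw [mem_bipartiteAbove] at hR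
      obtain ⟨hRA, hsub⟩ := hR
      have hlt : #(R \ S.erase x) = 1 := by
        rw [card_sdiff_of_subset hsub, card_erase_of_mem hx, (hA S hS).2, (hA R hRA).2]
        omega
      obtain ⟨y, hy⟩ := card_eq_one.1 hlt
      have hyR : y ∈ R \ S.erase x := hy ▸ mem_singleton_self y
      refine mem_image.2 ⟨y, sdiff_subset_sdiff (hA R hRA).1 le_rfl hyR, ?_⟩
      rw [insert_eq, ← hy, sdiff_union_of_subset hsub]
  exact Nat.le_of_mul_le_mul_right hmul (by omega)

open Finset FinsetFamily in
/-- The shadows of the link and of the deletion at `x` embed disjointly into the shadow. -/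
theorem card_shadow_memberSubfamily_add_le {α : Type*} [DecidableEq α]
    (A : Finset (Finset α)) (x : α) :
    #(∂ (A.memberSubfamily x)) + #(∂ (A.nonMemberSubfamily x)) ≤ #(∂ A) := by
  rw [← card_memberSubfamily_add_card_nonMemberSubfamily x (∂ A)]
  refine Nat.add_le_add (card_le_card fun T hT => ?_) (card_le_card fun T hT => ?_)
  · obtain ⟨S, hS, y, hy, rfl⟩ := mem_shadow_iff.1 hT
    rw [mem_memberSubfamily] at hS ⊢
    have hxy : x ≠ y := fun h => hS.2 (h ▸ hy)
    refine ⟨?_, fun h => hS.2 (mem_of_mem_erase h)⟩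
    rw [← erase_insert_of_ne hxy]
    exact erase_mem_shadow hS.1 (mem_insert_of_mem hy)
  · obtain ⟨S, hS, y, hy, rfl⟩ := mem_shadow_iff.1 hT
    rw [mem_nonMemberSubfamily] at hS ⊢
    exact ⟨erase_mem_shadow hS.1 hy, fun h => hS.2 (mem_of_mem_erase h)⟩

open Finset FinsetFamily in
/-- A nonempty family of `k`-subsets of a set with at most `2 * k - 2` elements has a shadow
exceeding it by at least `k - 1`. -/
theorem card_add_le_card_shadow_add_one {α : Type*} [DecidableEq α] {A : Finset (Finset α)}
    {V : Finset α} {k : ℕ} (hA : ∀ S ∈ A, S ⊆ V ∧ #S = k) (hne : A.Nonempty)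
    (hV : #V + 2 ≤ 2 * k) : #A + k ≤ #(∂ A) + 1 := by
  induction V using Finset.strongInduction generalizing A with
  | H V ih =>
  obtain ⟨S, hS⟩ := hne
  by_cases hVS : V ⊆ S
  · have hAV : A ⊆ {S} := fun T hT => mem_singleton.2 <|
      eq_of_subset_of_card_le ((hA T hT).1.trans hVS) (by rw [(hA S hS).2, (hA T hT).2])
    have hcard : #A ≤ 1 := by simpa using card_le_card hAV
    have hshadow : k ≤ #(∂ A) := by
      rw [← (hA S hS).2, ← card_image_of_injOn S.erase_injOn]
      exact card_le_card (image_subset_iff.2 fun x hx => erase_mem_shadow hS hx)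
    omega
  · obtain ⟨x, hxV, hxS⟩ := not_subset.1 hVS
    have hVx : #(V.erase x) + 1 = #V := card_erase_add_one hxV
    have hdel := ih (V.erase x) (erase_ssubset hxV) (A := A.nonMemberSubfamily x)
      (fun T hT => by
        rw [mem_nonMemberSubfamily] at hT
        exact ⟨subset_erase.2 ⟨(hA T hT.1).1, hT.2⟩, (hA T hT.1).2⟩)
      ⟨S, mem_nonMemberSubfamily.2 ⟨hS, hxS⟩⟩ (by omega)
    have hlink : #(A.memberSubfamily x) ≤ #(∂ (A.memberSubfamily x)) :=
      card_le_card_shadow_of_subset_s11 (V := V.erase x) (k := k - 1)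
        (fun T hT => by
          rw [mem_memberSubfamily] at hT
          obtain ⟨hsub, hcard⟩ := hA _ hT.1
          rw [card_insert_of_notMem hT.2] at hcard
          exact ⟨subset_erase.2 ⟨(subset_insert _ _).trans hsub, hT.2⟩, by omega⟩)
        (by omega)
    have hsplit := card_shadow_memberSubfamily_add_le A x
    have hcard := card_memberSubfamily_add_card_nonMemberSubfamily x A
    omega

open Finset FinsetFamily in
/-- In an antichain whose members have at most `k + 1` elements, replacing the top layer by its
shadow gives an antichain, which is larger by at least `k` when `k` is at least half the size of the
ground set. -/
theorem IsSperner.exists_card_add_le {n k : ℕ} {F : Finset (Finset (Fin n))} (hS : IsSperner F)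
    (hmax : ∀ A ∈ F, #A ≤ k + 1) (hatt : ∃ A ∈ F, #A = k + 1) (hk : n ≤ 2 * k) :
    ∃ G : Finset (Finset (Fin n)), IsSperner G ∧ (∀ A ∈ G, #A ≤ k) ∧ (∃ A ∈ G, #A = k) ∧
      #F + k ≤ #G := by
  set T : Finset (Finset (Fin n)) := {A ∈ F | #A = k + 1} with hT
  have hshadow : ∀ B ∈ ∂ T, #B = k ∧ ∃ A ∈ F, B ⊆ A ∧ #A = k + 1 := by
    intro B hB
    obtain ⟨A, hA, x, hx, rfl⟩ := mem_shadow_iff.1 hB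
    obtain ⟨hAF, hAk⟩ := mem_filter.1 hA
    exact ⟨by rw [card_erase_of_mem hx, hAk, Nat.add_sub_cancel], A, hAF, erase_subset _ _, hAk⟩
  have hrest : ∀ B ∈ F \ T, B ∈ F ∧ #B ≤ k := by
    intro B hB
    simp only [hT, mem_sdiff, mem_filter, not_and] at hB
    have := hmax B hB.1
    have := hB.2 hB.1
    exact ⟨hB.1, by omega⟩
  have hnot : ∀ B ∈ ∂ T, ∀ C ∈ F, ¬ C ⊆ B := by
    intro B hB C hC hCB
    obtain ⟨hBk, A, hA, hBA, hAk⟩ := hshadow B hB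
    obtain rfl := hS C hC A hA (hCB.trans hBA)
    have := card_le_card hCB
    omega
  have hdisj : Disjoint (F \ T) (∂ T) := disjoint_left.2 fun B hB hB' =>
    hnot B hB' B (hrest B hB).1 Subset.rfl
  obtain ⟨A, hA, hAk⟩ := hatt
  have hAT : A ∈ T := mem_filter.2 ⟨hA, hAk⟩
  have hgain := card_add_le_card_shadow_add_one (A := T) (V := univ) (k := k + 1)
    (fun S hS => ⟨subset_univ S, (mem_filter.1 hS).2⟩) ⟨A, hAT⟩ (by rw [card_fin]; omega)
  refine ⟨F \ T ∪ ∂ T, ?_, ?_, ?_, ?_⟩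
  · intro B hB C hC hBC
    rcases mem_union.1 hB with hB | hB <;> rcases mem_union.1 hC with hC | hC
    · exact hS B (hrest B hB).1 C (hrest C hC).1 hBC
    · exact (hnot C hC B (hrest B hB).1 hBC).elim
    · refine eq_of_subset_of_card_le hBC ?_
      rw [(hshadow B hB).1]
      exact (hrest C hC).2
    · exact eq_of_subset_of_card_le hBC (by rw [(hshadow B hB).1, (hshadow C hC).1])
  · intro B hB
    rcases mem_union.1 hB with hB | hB
    · exact (hrest B hB).2
    · exact (hshadow B hB).1.le
  · obtain ⟨x, hx⟩ : A.Nonempty := card_pos.1 (by omega)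
    have hmem := erase_mem_shadow hAT hx
    exact ⟨_, mem_union_right _ hmem, (hshadow _ hmem).1⟩
  · rw [card_union_of_disjoint hdisj]
    have := card_sdiff_add_card_eq_card (filter_subset (fun A => #A = k + 1) F)
    rw [← hT] at this
    omega

open Finset in
/-- A Sperner family whose largest member has `(n + 1) / 2 + d` elements falls short of the middle
binomial coefficient by at least the sum of the layer sizes it rises above. -/
theorem IsSperner.card_add_sum_range_le {n d : ℕ} {F : Finset (Finset (Fin n))}
    (hS : IsSperner F) (hmax : ∀ A ∈ F, #A ≤ (n + 1) / 2 + d)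
    (hatt : ∃ A ∈ F, #A = (n + 1) / 2 + d) :
    #F + ∑ i ∈ range d, ((n + 1) / 2 + i) ≤ n.choose (n / 2) := by
  induction d generalizing F with
  | zero =>
    have hanti : IsAntichain (· ⊆ ·) (F : Set (Finset (Fin n))) :=
      fun A hA B hB hne hAB => hne (hS A hA B hB hAB)
    simpa using hanti.sperner
  | succ d ih =>
    obtain ⟨G, hG, hGmax, hGatt, hcard⟩ :=
      hS.exists_card_add_le (k := (n + 1) / 2 + d) hmax hatt (by omega)
    have := ih hG hGmax hGatt
    rw [sum_range_succ]
    omega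

/-- A nonempty Sperner family with minimum member size `l = ⌊n/2⌋` and maximum member
size `u > ⌈n/2⌉` has
`|F| ≤ C(n, ⌊n/2⌋) - (u-⌈n/2⌉)·⌈n/2⌉ - (u-⌈n/2⌉)(u-⌈n/2⌉-1)/2`. -/
theorem sperner_bound_min_middle_max_large {n l u : ℕ}
    (F : Finset (Finset (Fin n))) (hne : F.Nonempty) (hS : IsSperner F)
    (hlmin : ∀ A ∈ F, l ≤ A.card) (hlatt : ∃ A ∈ F, A.card = l)
    (humax : ∀ A ∈ F, A.card ≤ u) (huatt : ∃ A ∈ F, A.card = u)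
    (hl : l = n / 2) (hu : (n + 1) / 2 < u) :
    F.card + (u - (n + 1) / 2) * ((n + 1) / 2) +
      (u - (n + 1) / 2) * (u - (n + 1) / 2 - 1) / 2 ≤ n.choose (n / 2) := by
  obtain ⟨d, rfl⟩ := Nat.exists_eq_add_of_le hu.le
  have h := hS.card_add_sum_range_le humax huatt
  rw [Finset.sum_add_distrib, Finset.sum_const, Finset.card_range, smul_eq_mul,
    Finset.sum_range_id, ← add_assoc] at h
  rwa [Nat.add_sub_cancel_left]
end

section
/- Let n ≥ 3 and let F be a nonempty Sperner family of subsets of [n] whose minimum member size l satisfies l ≤ ⌊n/2⌋. Then for every integer i with l ≤ i ≤ ⌊n/2⌋, setting F_−^i = {B ∈ F : |B| ≤ i}, one has |∇_i(F_−^i)| ≥ |F_−^i| + (i − l)(n − i). -/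
/-- The `r`-shade of a family `G`: all `r`-element subsets of `[n]` containing
some member of `G`. -/
def shade {n : ℕ} (G : Finset (Finset (Fin n))) (r : ℕ) : Finset (Finset (Fin n)) :=
  Finset.univ.filter fun B => B.card = r ∧ ∃ A ∈ G, A ⊆ B

/-- The subsets of `S` of size `r` that contain some member of `G`. -/
def shadeIn {α : Type*} [DecidableEq α] (S : Finset α) (G : Finset (Finset α)) (r : ℕ) :
    Finset (Finset α) :=
  (S.powersetCard r).filter fun B => ∃ A ∈ G, A ⊆ B

theorem mem_shadeIn {α : Type*} [DecidableEq α] {S B : Finset α} {G : Finset (Finset α)}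
    {r : ℕ} : B ∈ shadeIn S G r ↔ (B ⊆ S ∧ B.card = r) ∧ ∃ A ∈ G, A ⊆ B := by
  simp [shadeIn, Finset.mem_powersetCard]

/-- Below the middle level, the shade of a uniform family is at least as large as the family. -/
theorem card_le_card_shadeIn {α : Type*} [DecidableEq α] {S : Finset α}
    {G : Finset (Finset α)} {i : ℕ} (hG : G ⊆ S.powersetCard i) (hS : 2 * i + 1 ≤ S.card) :
    G.card ≤ (shadeIn S G (i + 1)).card := by
  have key : G.card * (i + 1) ≤ (shadeIn S G (i + 1)).card * (i + 1) := by
    refine Finset.card_mul_le_card_mul (fun A B : Finset α => A ⊆ B) (fun A hA => ?_)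
      (fun B hB => ?_)
    · obtain ⟨hAS, hAi⟩ := Finset.mem_powersetCard.1 (hG hA)
      have hsub : (S \ A).image (insert · A) ⊆
          (shadeIn S G (i + 1)).bipartiteAbove (fun A B : Finset α => A ⊆ B) A := by
        intro B hB
        obtain ⟨x, hx, rfl⟩ := Finset.mem_image.1 hB
        obtain ⟨hxS, hxA⟩ := Finset.mem_sdiff.1 hx
        refine Finset.mem_filter.2 ⟨mem_shadeIn.2 ⟨⟨Finset.insert_subset hxS hAS, ?_⟩,
          A, hA, Finset.subset_insert _ _⟩, Finset.subset_insert _ _⟩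
        rw [Finset.card_insert_of_notMem hxA, hAi]
      have hinj : Set.InjOn (insert · A) ((S \ A : Finset α) : Set α) := by
        intro x hx y hy hxy
        have hxA := (Finset.mem_sdiff.1 (Finset.mem_coe.1 hx)).2
        have : x ∈ insert y A := by
          rw [← show insert x A = insert y A from hxy]
          exact Finset.mem_insert_self _ _
        exact (Finset.mem_insert.1 this).resolve_right hxA
      have hcard := Finset.card_le_card hsub
      rw [Finset.card_image_of_injOn hinj, Finset.card_sdiff_of_subset hAS, hAi] at hcard
      omega
    · have hBi := (mem_shadeIn.1 hB).1.2
      have hsub : G.bipartiteBelow (fun A B : Finset α => A ⊆ B) B ⊆ B.powersetCard i := by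
        intro A hA
        obtain ⟨hAG, hAB⟩ := Finset.mem_filter.1 hA
        exact Finset.mem_powersetCard.2 ⟨hAB, (Finset.mem_powersetCard.1 (hG hAG)).2⟩
      have hcard := Finset.card_le_card hsub
      rwa [Finset.card_powersetCard, hBi, Nat.choose_succ_self_right] at hcard
  exact Nat.le_of_mul_le_mul_right key i.succ_pos

/-- Strictly below the middle level, the shade of a nonempty uniform family of `i`-sets exceeds
the family by at least `|S| - i - 1`. -/
theorem card_add_le_card_shadeIn {α : Type*} [DecidableEq α] {i : ℕ} {S : Finset α}
    {G : Finset (Finset α)} (hG : G ⊆ S.powersetCard i) (hne : G.Nonempty)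
    (hS : 2 * i + 2 ≤ S.card) :
    G.card + (S.card - i - 1) ≤ (shadeIn S G (i + 1)).card := by
  induction i generalizing S G with
  | zero =>
    have hG' : G = {∅} := by
      rw [Finset.powersetCard_zero] at hG
      exact (Finset.subset_singleton_iff.1 hG).resolve_left hne.ne_empty
    have : shadeIn S G (0 + 1) = S.powersetCard 1 := by
      ext B
      simp [mem_shadeIn, hG', Finset.mem_powersetCard]
    rw [this, Finset.card_powersetCard, Nat.choose_one_right, hG', Finset.card_singleton]
    omega
  | succ i ih =>
    obtain ⟨A, hA⟩ := hne
    obtain ⟨hAS, hAi⟩ := Finset.mem_powersetCard.1 (hG hA)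
    obtain ⟨x, hxA⟩ : A.Nonempty := Finset.card_pos.1 (by omega)
    have hxS := hAS hxA
    have hT : (S.erase x).card = S.card - 1 := Finset.card_erase_of_mem hxS
    set G₀ := G.filter fun B => x ∉ B with hG₀
    set G₁ := (G.filter fun B => x ∈ B).image (Finset.erase · x) with hG₁
    have hcard : G.card = G₁.card + G₀.card := by
      rw [hG₁, hG₀, Finset.card_image_of_injOn, Finset.card_filter_add_card_filter_not]
      intro B hB C hC h
      exact Finset.erase_injOn' x (by simpa using (Finset.mem_filter.1 hB).2)
        (by simpa using (Finset.mem_filter.1 hC).2) h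
    have h₀ : G₀ ⊆ (S.erase x).powersetCard (i + 1) := by
      intro B hB
      obtain ⟨hBG, hxB⟩ := Finset.mem_filter.1 hB
      obtain ⟨hBS, hBi⟩ := Finset.mem_powersetCard.1 (hG hBG)
      exact Finset.mem_powersetCard.2 ⟨Finset.subset_erase.2 ⟨hBS, hxB⟩, hBi⟩
    have h₁ : G₁ ⊆ (S.erase x).powersetCard i := by
      intro C hC
      obtain ⟨B, hB, rfl⟩ := Finset.mem_image.1 hC
      obtain ⟨hBG, hxB⟩ := Finset.mem_filter.1 hB
      obtain ⟨hBS, hBi⟩ := Finset.mem_powersetCard.1 (hG hBG)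
      refine Finset.mem_powersetCard.2 ⟨Finset.erase_subset_erase _ hBS, ?_⟩
      rw [Finset.card_erase_of_mem hxB, hBi, Nat.add_sub_cancel]
    have hne₁ : G₁.Nonempty :=
      ⟨A.erase x, Finset.mem_image_of_mem _ (Finset.mem_filter.2 ⟨hA, hxA⟩)⟩
    have b₀ := card_le_card_shadeIn h₀ (by omega)
    have b₁ := ih h₁ hne₁ (by omega)
    have notMem {B : Finset α} {H : Finset (Finset α)} {r : ℕ}
        (hB : B ∈ shadeIn (S.erase x) H r) : x ∉ B :=
      fun h => Finset.notMem_erase x S ((mem_shadeIn.1 hB).1.1 h)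
    have hdisj : Disjoint (shadeIn (S.erase x) G₀ (i + 1 + 1))
        ((shadeIn (S.erase x) G₁ (i + 1)).image (insert x)) := by
      refine Finset.disjoint_left.2 fun B hB hB' => notMem hB ?_
      obtain ⟨C, -, rfl⟩ := Finset.mem_image.1 hB'
      exact Finset.mem_insert_self _ _
    have himage : ((shadeIn (S.erase x) G₁ (i + 1)).image (insert x)).card =
        (shadeIn (S.erase x) G₁ (i + 1)).card := by
      refine Finset.card_image_of_injOn fun B hB C hC h => ?_
      rw [← Finset.erase_insert (notMem hB), ← Finset.erase_insert (notMem hC)]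
      exact congrArg (Finset.erase · x) h
    have hsub : shadeIn (S.erase x) G₀ (i + 1 + 1) ∪
        (shadeIn (S.erase x) G₁ (i + 1)).image (insert x) ⊆ shadeIn S G (i + 1 + 1) := by
      refine Finset.union_subset (fun B hB => ?_) (fun B hB => ?_)
      · obtain ⟨⟨hBS, hBi⟩, C, hC, hCB⟩ := mem_shadeIn.1 hB
        exact mem_shadeIn.2 ⟨⟨hBS.trans (Finset.erase_subset _ _), hBi⟩, C,
          (Finset.mem_filter.1 hC).1, hCB⟩
      · obtain ⟨C, hC, rfl⟩ := Finset.mem_image.1 hB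
        obtain ⟨⟨hCS, hCi⟩, D, hD, hDC⟩ := mem_shadeIn.1 hC
        obtain ⟨E, hE, rfl⟩ := Finset.mem_image.1 hD
        refine mem_shadeIn.2 ⟨⟨Finset.insert_subset hxS
          (hCS.trans (Finset.erase_subset _ _)), ?_⟩, E, (Finset.mem_filter.1 hE).1, ?_⟩
        · rw [Finset.card_insert_of_notMem (notMem hC), hCi]
        · exact Finset.subset_insert_iff.2 hDC
    have := Finset.card_le_card hsub
    rw [Finset.card_union_of_disjoint hdisj, himage] at this
    omega

theorem mem_shade {n r : ℕ} {G : Finset (Finset (Fin n))} {B : Finset (Fin n)} :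
    B ∈ shade G r ↔ B.card = r ∧ ∃ A ∈ G, A ⊆ B := by
  simp [shade]

/-- For `n ≥ 3` and a nonempty Sperner family `F` with minimum member size
`l ≤ ⌊n/2⌋`, for every `i` with `l ≤ i ≤ ⌊n/2⌋`, the family
`F₋ⁱ = {B ∈ F : |B| ≤ i}` satisfies `|∇ᵢ(F₋ⁱ)| ≥ |F₋ⁱ| + (i-l)(n-i)`. -/
theorem sperner_shade_lower_bound {n l : ℕ} (hn : 3 ≤ n)
    (F : Finset (Finset (Fin n))) (hne : F.Nonempty) (hS : IsSperner F)
    (hlmin : ∀ A ∈ F, l ≤ A.card) (hlatt : ∃ A ∈ F, A.card = l)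
    (hl : l ≤ n / 2) :
    ∀ i : ℕ, l ≤ i → i ≤ n / 2 →
      (F.filter fun B => B.card ≤ i).card + (i - l) * (n - i) ≤
        (shade (F.filter fun B => B.card ≤ i) i).card := by
  intro i hi
  induction i, hi using Nat.le_induction with
  | base =>
    intro _
    rw [Nat.sub_self, zero_mul, add_zero]
    refine Finset.card_le_card fun B hB => mem_shade.2 ⟨?_, B, hB, subset_rfl⟩
    obtain ⟨hBF, hBl⟩ := Finset.mem_filter.1 hB
    exact hBl.antisymm (hlmin B hBF)
  | succ i hi ih =>
    intro hin
    have ih := ih (by omega)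
    set G := shade (F.filter fun B => B.card ≤ i) i with hGdef
    have hG : G ⊆ Finset.univ.powersetCard i := fun B hB =>
      Finset.mem_powersetCard.2 ⟨Finset.subset_univ _, (mem_shade.1 hB).1⟩
    have hGne : G.Nonempty := by
      obtain ⟨A, hA, hAl⟩ := hlatt
      obtain ⟨B, hAB, -, hB⟩ := Finset.exists_subsuperset_card_eq (Finset.subset_univ A)
        (hAl.trans_le hi) (by rw [Finset.card_univ, Fintype.card_fin]; omega)
      exact ⟨B, mem_shade.2 ⟨hB, A, Finset.mem_filter.2 ⟨hA, hAl.trans_le hi⟩, hAB⟩⟩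
    have hstep := card_add_le_card_shadeIn hG hGne
      (by rw [Finset.card_univ, Fintype.card_fin]; omega)
    rw [Finset.card_univ, Fintype.card_fin] at hstep
    have hsplit : (F.filter fun B => B.card ≤ i + 1).card =
        (F.filter fun B => B.card ≤ i).card + (F.filter fun B => B.card = i + 1).card := by
      rw [← Finset.card_union_of_disjoint, ← Finset.filter_or]
      · simp only [Nat.le_succ_iff]
      · exact Finset.disjoint_filter.2 fun B _ h h' => by omega
    have hdisj : Disjoint (F.filter fun B => B.card = i + 1)
        (shadeIn Finset.univ G (i + 1)) := by
      refine Finset.disjoint_left.2 fun B hB hB' => ?_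
      obtain ⟨hBF, hBi⟩ := Finset.mem_filter.1 hB
      obtain ⟨-, C, hC, hCB⟩ := mem_shadeIn.1 hB'
      obtain ⟨-, A, hA, hAC⟩ := mem_shade.1 hC
      obtain ⟨hAF, hAi⟩ := Finset.mem_filter.1 hA
      rw [hS A hAF B hBF (hAC.trans hCB)] at hAi
      omega
    have hsub : (F.filter fun B => B.card = i + 1) ∪ shadeIn Finset.univ G (i + 1) ⊆
        shade (F.filter fun B => B.card ≤ i + 1) (i + 1) := by
      refine Finset.union_subset (fun B hB => ?_) (fun B hB => ?_)
      · obtain ⟨hBF, hBi⟩ := Finset.mem_filter.1 hB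
        exact mem_shade.2 ⟨hBi, B, Finset.mem_filter.2 ⟨hBF, hBi.le⟩, subset_rfl⟩
      · obtain ⟨⟨-, hBi⟩, C, hC, hCB⟩ := mem_shadeIn.1 hB
        obtain ⟨-, A, hA, hAC⟩ := mem_shade.1 hC
        obtain ⟨hAF, hAi⟩ := Finset.mem_filter.1 hA
        exact mem_shade.2 ⟨hBi, A, Finset.mem_filter.2 ⟨hAF, by omega⟩, hAC.trans hCB⟩
    have hle := Finset.card_le_card hsub
    rw [Finset.card_union_of_disjoint hdisj] at hle
    have harith : (i + 1 - l) * (n - (i + 1)) ≤ (i - l) * (n - i) + (n - i - 1) := by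
      rw [Nat.sub_add_comm hi, add_mul, one_mul, Nat.sub_sub n i 1]
      gcongr
      omega
    omega
end
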